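/- arXiv:1501.00868 — 2 statements merged into one kernel-verified Lean document; each statement's English description precedes it below -/
import Mathlib

section
/- Let {X_n, n ≥ 1} be a strictly stationary sequence of associated random variables with |X_n| ≤ C_1 < ∞ for all n. Assume Σ_{j=n+1}^∞ Cov(X_1, X_j) = O(n^{−(k−2)/2}) for some natural number k > 2. Let b_n = O(n^{1+u/2−p}) for some u > 1 and p ∈ (0,1) satisfying (k/2)(1+u) − (k+1)p > 1. Then sup_{x ∈ [−C_1, C_1]} | Σ_{j=1}^n (|X_j − x| − E|X_j − x|) | / b_n → 0 almost surely as n → ∞. -/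
open MeasureTheory ProbabilityTheory Filter Topology

noncomputable section

variable {Ω : Type*} [MeasurableSpace Ω]

/-- Covariance of two real-valued random variables. -/
def cov (μ : Measure Ω) (f g : Ω → ℝ) : ℝ :=
  ∫ ω, f ω * g ω ∂μ - (∫ ω, f ω ∂μ) * (∫ ω, g ω ∂μ)

/-- A family of real-valued random variables is *associated* if every two coordinatewise
nondecreasing functions of any finite subcollection have nonnegative covariance
(whenever the relevant integrals exist). -/
def IsAssociated (μ : Measure Ω) {ι : Type*} (X : ι → Ω → ℝ) : Prop :=
  ∀ (S : Finset ι) (h g : (S → ℝ) → ℝ), Monotone h → Monotone g →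
    Measurable h → Measurable g →
    Integrable (fun ω => h fun i => X i ω) μ →
    Integrable (fun ω => g fun i => X i ω) μ →
    Integrable (fun ω => h (fun i => X i ω) * g (fun i => X i ω)) μ →
    0 ≤ cov μ (fun ω => h fun i => X i ω) (fun ω => g fun i => X i ω)

/-- Strict stationarity of the sequence `X 1, X 2, ...`. -/
def StrictStationary (μ : Measure Ω) (X : ℕ → Ω → ℝ) : Prop :=
  ∀ k n : ℕ, Measure.map (fun ω => fun i : Fin n => X (1 + (i : ℕ) + k) ω) μ =
    Measure.map (fun ω => fun i : Fin n => X (1 + (i : ℕ)) ω) μ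

/-- Convergence in distribution to the standard normal law `N(0,1)`. -/
def TendstoStdGaussian (μ : Measure Ω) (Z : ℕ → Ω → ℝ) : Prop :=
  ∀ f : BoundedContinuousFunction ℝ ℝ,
    Tendsto (fun n => ∫ ω, f (Z n ω) ∂μ) atTop
      (𝓝 (∫ x, f x ∂(gaussianReal 0 1)))

/-- One-dimensional dyadic chaining bound. -/
theorem abs_sub_zero_le_dyadic (N : ℕ) : ∀ (f : ℕ → ℝ) (i : ℕ), i ≤ 2 ^ N →
    |f i - f 0| ≤ ∑ r ∈ Finset.range (N + 1),
      √(∑ s ∈ Finset.range (2 ^ (N - r)), (f ((s + 1) * 2 ^ r) - f (s * 2 ^ r)) ^ 2) := by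
  induction N with
  | zero =>
    intro f i hi
    have : i = 0 ∨ i = 1 := by simp at hi; omega
    rcases this with rfl | rfl <;> simp [Real.sqrt_sq_eq_abs]
  | succ N ih =>
    intro f i hi
    have hodd : ∀ q, q < 2 ^ N → |f (2 * q + 1) - f (2 * q)| ≤
        √(∑ s ∈ Finset.range (2 ^ (N + 1)), (f (s + 1) - f s) ^ 2) := by
      intro q hq
      apply Real.abs_le_sqrt
      exact Finset.single_le_sum (f := fun s => (f (s + 1) - f s) ^ 2)
        (fun s _ => sq_nonneg _) (Finset.mem_range.2 (by rw [pow_succ]; omega))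
    have heven : ∀ q, q ≤ 2 ^ N → |f (2 * q) - f 0| ≤ ∑ r ∈ Finset.range (N + 1),
        √(∑ s ∈ Finset.range (2 ^ (N - r)),
          (f ((s + 1) * 2 ^ (r + 1)) - f (s * 2 ^ (r + 1))) ^ 2) := by
      intro q hq
      refine (ih (fun q => f (2 * q)) q hq).trans (le_of_eq ?_)
      refine Finset.sum_congr rfl fun r _ => ?_
      congr 1
      refine Finset.sum_congr rfl fun s _ => ?_
      simp only [pow_succ]
      rw [show 2 * ((s + 1) * 2 ^ r) = (s + 1) * (2 ^ r * 2) by ring,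
        show 2 * (s * 2 ^ r) = s * (2 ^ r * 2) by ring]
    rw [Finset.sum_range_succ']
    simp only [Nat.add_sub_add_right, pow_zero, mul_one, Nat.sub_zero]
    rcases Nat.even_or_odd' i with ⟨q, rfl | rfl⟩
    · have := heven q (by rw [pow_succ] at hi; omega)
      have h0 := Real.sqrt_nonneg (∑ s ∈ Finset.range (2 ^ (N + 1)), (f (s + 1) - f s) ^ 2)
      linarith
    · have h1 := heven q (by rw [pow_succ] at hi; omega)
      have h2 := hodd q (by rw [pow_succ] at hi; omega)
      have h3 := abs_sub_le (f (2 * q + 1)) (f (2 * q)) (f 0)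
      linarith

theorem sq_sub_zero_le_dyadic (N : ℕ) (f : ℕ → ℝ) (i : ℕ) (hi : i ≤ 2 ^ N) :
    (f i - f 0) ^ 2 ≤ (N + 1) * ∑ r ∈ Finset.range (N + 1),
      ∑ s ∈ Finset.range (2 ^ (N - r)), (f ((s + 1) * 2 ^ r) - f (s * 2 ^ r)) ^ 2 := by
  rw [← sq_abs]
  refine (pow_le_pow_left₀ (abs_nonneg _) (abs_sub_zero_le_dyadic N f i hi) 2).trans ?_
  refine sq_sum_le_card_mul_sum_sq.trans (le_of_eq ?_)
  rw [Finset.card_range]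
  push_cast
  congr 1
  exact Finset.sum_congr rfl fun r _ => Real.sq_sqrt (Finset.sum_nonneg fun s _ => sq_nonneg _)

/-- Sum of squared dyadic increments controlling a two-parameter array at level `N`. -/
def dyadicEnergy (N : ℕ) (F : ℕ → ℕ → ℝ) : ℝ :=
  (N + 1) * ∑ r ∈ Finset.range (N + 1), ∑ s ∈ Finset.range (2 ^ (N - r)),
    (2 * (F ((s + 1) * 2 ^ r) 0 - F (s * 2 ^ r) 0) ^ 2 +
      2 * ((N + 1) * ∑ q ∈ Finset.range (N + 1), ∑ t ∈ Finset.range (2 ^ (N - q)),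
        ((F ((s + 1) * 2 ^ r) ((t + 1) * 2 ^ q) - F (s * 2 ^ r) ((t + 1) * 2 ^ q)) -
          (F ((s + 1) * 2 ^ r) (t * 2 ^ q) - F (s * 2 ^ r) (t * 2 ^ q))) ^ 2))

theorem dyadicEnergy_nonneg (N : ℕ) (F : ℕ → ℕ → ℝ) : 0 ≤ dyadicEnergy N F := by
  unfold dyadicEnergy; positivity

theorem sq_le_dyadicEnergy (N : ℕ) (F : ℕ → ℕ → ℝ) (hF : ∀ i, F 0 i = 0) (m i : ℕ)
    (hm : m ≤ 2 ^ N) (hi : i ≤ 2 ^ N) : F m i ^ 2 ≤ dyadicEnergy N F := by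
  have h := sq_sub_zero_le_dyadic N (fun m => F m i) m hm
  simp only [hF, sub_zero] at h
  refine h.trans ?_
  unfold dyadicEnergy
  gcongr with r _ s _
  have h2 := sq_sub_zero_le_dyadic N (fun i => F ((s + 1) * 2 ^ r) i - F (s * 2 ^ r) i) i hi
  set a := F ((s + 1) * 2 ^ r) i - F (s * 2 ^ r) i
  set c := F ((s + 1) * 2 ^ r) 0 - F (s * 2 ^ r) 0
  nlinarith [sq_nonneg (a - 2 * c)]

/-- Second-moment bounds on dyadic rectangles bound the expected dyadic energy. -/
theorem integral_dyadicEnergy_le (μ : Measure Ω) (N : ℕ) (F : ℕ → ℕ → Ω → ℝ) (A : ℝ)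
    (hF : ∀ m i, MemLp (F m i) 2 μ)
    (h0 : ∀ r s, ∫ ω, (F ((s + 1) * 2 ^ r) 0 ω - F (s * 2 ^ r) 0 ω) ^ 2 ∂μ ≤ A * 2 ^ r)
    (h1 : ∀ r s q t, q ≤ N → t < 2 ^ (N - q) → ∫ ω,
      ((F ((s + 1) * 2 ^ r) ((t + 1) * 2 ^ q) ω - F (s * 2 ^ r) ((t + 1) * 2 ^ q) ω) -
        (F ((s + 1) * 2 ^ r) (t * 2 ^ q) ω - F (s * 2 ^ r) (t * 2 ^ q) ω)) ^ 2 ∂μ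
          ≤ A * 2 ^ r / 2 ^ (N - q)) :
    Integrable (fun ω => dyadicEnergy N fun m i => F m i ω) μ ∧
    ∫ ω, dyadicEnergy N (fun m i => F m i ω) ∂μ ≤ 4 * A * (N + 1) ^ 4 * 2 ^ N := by
  have i0 : ∀ r s, Integrable (fun ω => (F ((s + 1) * 2 ^ r) 0 ω - F (s * 2 ^ r) 0 ω) ^ 2) μ :=
    fun r s => ((hF _ _).sub (hF _ _)).integrable_sq
  have i1 : ∀ r s q t, Integrable (fun ω =>
      ((F ((s + 1) * 2 ^ r) ((t + 1) * 2 ^ q) ω - F (s * 2 ^ r) ((t + 1) * 2 ^ q) ω) -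
        (F ((s + 1) * 2 ^ r) (t * 2 ^ q) ω - F (s * 2 ^ r) (t * 2 ^ q) ω)) ^ 2) μ :=
    fun r s q t => (((hF _ _).sub (hF _ _)).sub ((hF _ _).sub (hF _ _))).integrable_sq
  have hA : 0 ≤ A := by
    have := (integral_nonneg fun ω => sq_nonneg _).trans (h0 0 0)
    simpa using this
  unfold dyadicEnergy
  have i2 : ∀ r s, Integrable (fun ω => ∑ q ∈ Finset.range (N + 1),
      ∑ t ∈ Finset.range (2 ^ (N - q)),
      ((F ((s + 1) * 2 ^ r) ((t + 1) * 2 ^ q) ω - F (s * 2 ^ r) ((t + 1) * 2 ^ q) ω) -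
        (F ((s + 1) * 2 ^ r) (t * 2 ^ q) ω - F (s * 2 ^ r) (t * 2 ^ q) ω)) ^ 2) μ :=
    fun r s => integrable_finsetSum _ fun q _ => integrable_finsetSum _ fun t _ => i1 r s q t
  have i3 : ∀ r s, Integrable (fun ω =>
      (2 * (F ((s + 1) * 2 ^ r) 0 ω - F (s * 2 ^ r) 0 ω) ^ 2 +
      2 * ((N + 1) * ∑ q ∈ Finset.range (N + 1), ∑ t ∈ Finset.range (2 ^ (N - q)),
        ((F ((s + 1) * 2 ^ r) ((t + 1) * 2 ^ q) ω - F (s * 2 ^ r) ((t + 1) * 2 ^ q) ω) -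
          (F ((s + 1) * 2 ^ r) (t * 2 ^ q) ω - F (s * 2 ^ r) (t * 2 ^ q) ω)) ^ 2))) μ :=
    fun r s => ((i0 r s).const_mul 2).add (((i2 r s).const_mul _).const_mul 2)
  refine ⟨(integrable_finsetSum _ fun r _ => integrable_finsetSum _ fun s _ =>
    i3 r s).const_mul _, ?_⟩
  rw [integral_const_mul, integral_finsetSum _ fun r _ => integrable_finsetSum _ fun s _ => i3 r s]
  have key : ∀ r s, ∫ ω, (2 * (F ((s + 1) * 2 ^ r) 0 ω - F (s * 2 ^ r) 0 ω) ^ 2 +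
      2 * ((N + 1) * ∑ q ∈ Finset.range (N + 1), ∑ t ∈ Finset.range (2 ^ (N - q)),
        ((F ((s + 1) * 2 ^ r) ((t + 1) * 2 ^ q) ω - F (s * 2 ^ r) ((t + 1) * 2 ^ q) ω) -
          (F ((s + 1) * 2 ^ r) (t * 2 ^ q) ω - F (s * 2 ^ r) (t * 2 ^ q) ω)) ^ 2)) ∂μ ≤
      4 * A * (N + 1) ^ 2 * 2 ^ r := by
    intro r s
    rw [integral_add ((i0 r s).const_mul 2) (((i2 r s).const_mul _).const_mul 2),
      integral_const_mul, integral_const_mul, integral_const_mul,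
      integral_finsetSum _ fun q _ => integrable_finsetSum _ fun t _ => i1 r s q t]
    have hq : ∀ q ∈ Finset.range (N + 1), ∫ ω, ∑ t ∈ Finset.range (2 ^ (N - q)),
        ((F ((s + 1) * 2 ^ r) ((t + 1) * 2 ^ q) ω - F (s * 2 ^ r) ((t + 1) * 2 ^ q) ω) -
          (F ((s + 1) * 2 ^ r) (t * 2 ^ q) ω - F (s * 2 ^ r) (t * 2 ^ q) ω)) ^ 2 ∂μ ≤
        A * 2 ^ r := by
      intro q hq
      rw [integral_finsetSum _ fun t _ => i1 r s q t]
      refine (Finset.sum_le_sum fun t ht => h1 r s q t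
        (Nat.lt_succ_iff.1 (Finset.mem_range.1 hq)) (Finset.mem_range.1 ht)).trans (le_of_eq ?_)
      rw [Finset.sum_const, Finset.card_range, nsmul_eq_mul]
      push_cast
      field_simp
    have hsum := Finset.sum_le_sum hq
    rw [Finset.sum_const, Finset.card_range, nsmul_eq_mul] at hsum
    push_cast at hsum
    have hN : (1 : ℝ) ≤ ((N : ℝ) + 1) ^ 2 := one_le_pow₀ (by simp)
    have hAr : 0 ≤ A * 2 ^ r := by positivity
    have h3 := mul_le_mul_of_nonneg_left hsum (by positivity : (0 : ℝ) ≤ 2 * (N + 1))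
    have h4 := h0 r s
    nlinarith
  have hr : ∀ r ∈ Finset.range (N + 1), ∫ ω, ∑ s ∈ Finset.range (2 ^ (N - r)),
      (2 * (F ((s + 1) * 2 ^ r) 0 ω - F (s * 2 ^ r) 0 ω) ^ 2 +
      2 * ((N + 1) * ∑ q ∈ Finset.range (N + 1), ∑ t ∈ Finset.range (2 ^ (N - q)),
        ((F ((s + 1) * 2 ^ r) ((t + 1) * 2 ^ q) ω - F (s * 2 ^ r) ((t + 1) * 2 ^ q) ω) -
          (F ((s + 1) * 2 ^ r) (t * 2 ^ q) ω - F (s * 2 ^ r) (t * 2 ^ q) ω)) ^ 2)) ∂μ ≤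
      4 * A * (N + 1) ^ 2 * 2 ^ N := by
    intro r hr
    rw [integral_finsetSum _ fun s _ => i3 r s]
    refine (Finset.sum_le_sum fun s _ => key r s).trans (le_of_eq ?_)
    rw [Finset.sum_const, Finset.card_range, nsmul_eq_mul]
    push_cast
    have hrN : r ≤ N := Nat.lt_succ_iff.1 (Finset.mem_range.1 hr)
    rw [show (2 : ℝ) ^ N = 2 ^ (N - r) * 2 ^ r by rw [← pow_add, Nat.sub_add_cancel hrN]]
    ring
  have hfin := Finset.sum_le_sum hr
  rw [Finset.sum_const, Finset.card_range, nsmul_eq_mul] at hfin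
  push_cast at hfin
  calc _ ≤ ((N : ℝ) + 1) * (((N : ℝ) + 1) * (4 * A * (N + 1) ^ 2 * 2 ^ N)) := by gcongr
    _ = _ := by ring

theorem cov_eq_covariance (μ : Measure Ω) [IsProbabilityMeasure μ] {f g : Ω → ℝ}
    (hf : MemLp f 2 μ) (hg : MemLp g 2 μ) : cov μ f g = cov[f, g; μ] := by
  rw [covariance_eq_sub hf hg]; rfl

theorem IsAssociated.covariance_comp_nonneg {μ : Measure Ω} [IsProbabilityMeasure μ]
    {X : ℕ → Ω → ℝ} (hX : IsAssociated μ X) (i j : ℕ) {h g : ℝ → ℝ} (hh : Monotone h)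
    (hg : Monotone g) (hhi : MemLp (fun ω => h (X i ω)) 2 μ)
    (hgj : MemLp (fun ω => g (X j ω)) 2 μ) :
    0 ≤ cov[fun ω => h (X i ω), fun ω => g (X j ω); μ] := by
  rw [← cov_eq_covariance μ hhi hgj]
  have hi : i ∈ ({i, j} : Finset ℕ) := by simp
  have hj : j ∈ ({i, j} : Finset ℕ) := by simp
  exact hX {i, j} (fun v => h (v ⟨i, hi⟩)) (fun v => g (v ⟨j, hj⟩))
    (fun v w hvw => hh (hvw _)) (fun v w hvw => hg (hvw _))
    (hh.measurable.comp (measurable_pi_apply _)) (hg.measurable.comp (measurable_pi_apply _))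
    (hhi.integrable one_le_two) (hgj.integrable one_le_two) (hhi.integrable_mul hgj)

/-- Covariance comparison: a monotone function whose difference from twice the identity is
also monotone changes covariances of associated variables by a factor at most four. -/
theorem IsAssociated.covariance_comp_le {μ : Measure Ω} [IsProbabilityMeasure μ]
    {X : ℕ → Ω → ℝ} (hX : IsAssociated μ X) (i j : ℕ) {g : ℝ → ℝ} (hg : Monotone g)
    (hg' : Monotone fun t => 2 * t - g t) (hXi : MemLp (X i) 2 μ) (hXj : MemLp (X j) 2 μ)
    (hgi : MemLp (fun ω => g (X i ω)) 2 μ) (hgj : MemLp (fun ω => g (X j ω)) 2 μ) :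
    cov[fun ω => g (X i ω), fun ω => g (X j ω); μ] ≤ 4 * cov[X i, X j; μ] := by
  have h2i : MemLp (fun ω => 2 * X i ω) 2 μ := hXi.const_mul 2
  have h2j : MemLp (fun ω => 2 * X j ω) 2 μ := hXj.const_mul 2
  have h1 := hX.covariance_comp_nonneg i j hg' hg (h2i.sub hgi) hgj
  have h2 := hX.covariance_comp_nonneg i j monotone_id hg' hXi (h2j.sub hgj)
  rw [covariance_fun_sub_left h2i hgi hgj, covariance_const_mul_left] at h1
  simp only [id] at h2
  rw [covariance_fun_sub_right hXi h2j hgj, covariance_const_mul_right] at h2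
  linarith

theorem StrictStationary.covariance_eq {μ : Measure Ω} {X : ℕ → Ω → ℝ}
    (hX : StrictStationary μ X) (hmeas : ∀ j, Measurable (X j)) (i d : ℕ) (hi : 1 ≤ i) :
    cov[X i, X (i + d); μ] = cov[X 1, X (1 + d); μ] := by
  obtain ⟨k, rfl⟩ := Nat.exists_eq_add_of_le hi
  have h := hX k (d + 1)
  have key : ∀ k, cov[X (1 + k), X (1 + k + d); μ] =
      cov[fun v : Fin (d + 1) → ℝ => v 0, fun v => v (Fin.last d);
        Measure.map (fun ω => fun i : Fin (d + 1) => X (1 + (i : ℕ) + k) ω) μ] := by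
    intro k
    rw [covariance_map_fun (measurable_pi_apply _).aestronglyMeasurable
      (measurable_pi_apply _).aestronglyMeasurable]
    · simp only [Fin.val_zero, add_zero, Fin.val_last]
      rw [show 1 + d + k = 1 + k + d by ring]
    · exact (measurable_pi_lambda _ fun i => hmeas _).aemeasurable
  have h0 := key 0
  simp only [add_zero] at h0
  rw [key, h, h0]

theorem covariance_le_of_abs_le {μ : Measure Ω} [IsProbabilityMeasure μ] {f g : Ω → ℝ}
    {δ : ℝ} (hf : MemLp f 2 μ) (hg : MemLp g 2 μ) (hfδ : ∀ ω, |f ω| ≤ δ) (hgδ : ∀ ω, |g ω| ≤ δ) :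
    cov[f, g; μ] ≤ 2 * δ ^ 2 := by
  rw [covariance_eq_sub hf hg]
  have h1 : ‖∫ ω, (f * g) ω ∂μ‖ ≤ δ * δ := by
    have := norm_integral_le_of_norm_le_const (μ := μ) (f := f * g) (C := δ * δ)
      (.of_forall fun ω => by
        simp only [Pi.mul_apply, norm_mul, Real.norm_eq_abs]
        exact mul_le_mul (hfδ ω) (hgδ ω) (abs_nonneg _) ((abs_nonneg _).trans (hfδ ω)))
    simpa using this
  have h2 : ‖∫ ω, f ω ∂μ‖ ≤ δ := by
    simpa using norm_integral_le_of_norm_le_const (μ := μ) (f := f) (.of_forall hfδ)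
  have h3 : ‖∫ ω, g ω ∂μ‖ ≤ δ := by
    simpa using norm_integral_le_of_norm_le_const (μ := μ) (f := g) (.of_forall hgδ)
  have h4 : |(∫ ω, f ω ∂μ) * ∫ ω, g ω ∂μ| ≤ δ * δ := by
    rw [abs_mul]
    exact mul_le_mul h2 h3 (abs_nonneg _) ((abs_nonneg _).trans h2)
  have h5 := (abs_le.1 h4).1
  have h6 := (abs_le.1 h1).2
  linarith

theorem sum_comp_le_sum_of_injOn (w : ℕ → ℝ) (hw : ∀ d, 0 ≤ w d) (s t : Finset ℕ) (f : ℕ → ℕ)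
    (hf : Set.InjOn f s) (hst : ∀ j ∈ s, f j ∈ t) : ∑ j ∈ s, w (f j) ≤ ∑ d ∈ t, w d := by
  rw [← Finset.sum_image (f := w) hf]
  exact Finset.sum_le_sum_of_subset_of_nonneg (Finset.image_subset_iff.2 hst) fun d _ _ => hw d

theorem sum_sum_dist_le (w : ℕ → ℝ) (hw : ∀ d, 0 ≤ w d) (a n : ℕ) :
    ∑ i ∈ Finset.Ioc a (a + n), ∑ j ∈ Finset.Ioc a (a + n), w (Nat.dist i j) ≤
      2 * n * ∑ d ∈ Finset.range n, w d := by
  have hrow : ∀ i ∈ Finset.Ioc a (a + n), ∑ j ∈ Finset.Ioc a (a + n), w (Nat.dist i j) ≤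
      2 * ∑ d ∈ Finset.range n, w d := by
    intro i hi
    rw [Finset.mem_Ioc] at hi
    rw [← Finset.sum_filter_add_sum_filter_not _ (fun j => i ≤ j), two_mul]
    gcongr ?_ + ?_
    all_goals
      refine sum_comp_le_sum_of_injOn w hw _ _ (fun j => Nat.dist i j) ?_ ?_
      · intro j hj l hl h
        simp only [Finset.coe_filter, Set.mem_ofPred_eq, Finset.mem_Ioc, Nat.dist] at hj hl h
        omega
      · intro j hj
        simp only [Finset.mem_filter, Finset.mem_Ioc] at hj
        simp only [Finset.mem_range, Nat.dist]
        omega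
  refine (Finset.sum_le_sum hrow).trans (le_of_eq ?_)
  simp
  ring

theorem memLp_comp_of_abs_le (μ : Measure Ω) [IsProbabilityMeasure μ] {Y : Ω → ℝ} {g : ℝ → ℝ}
    {δ : ℝ} (hg : Measurable g) (hY : Measurable Y) (h : ∀ ω, |g (Y ω)| ≤ δ) :
    MemLp (fun ω => g (Y ω)) 2 μ :=
  MemLp.of_bound (hg.comp hY).aestronglyMeasurable δ (.of_forall h)

/-- Second-moment bound for block sums of a small monotone function of a bounded associated
stationary sequence with covariance tails of order `1 / n`. -/
theorem integral_sq_sum_comp_le (μ : Measure Ω) [IsProbabilityMeasure μ]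
    (X : ℕ → Ω → ℝ) (hmeas : ∀ j, Measurable (X j))
    (hstat : StrictStationary μ X) (hassoc : IsAssociated μ X)
    (C : ℝ) (hbdd : ∀ n : ℕ, 1 ≤ n → ∀ ω, |X n ω| ≤ C) (K : ℝ)
    (hK : ∀ n M : ℕ, 1 ≤ n → ∑ d ∈ Finset.range M, cov[X 1, X (1 + (n + d)); μ] ≤ K / n)
    (l : ℕ) (g : ℝ → ℝ) (hg : Monotone g) (hg' : Monotone fun t => 2 * t - g t)
    (hgb : ∀ j, 1 ≤ j → ∀ ω, |g (X j ω)| ≤ 2 * C / 2 ^ l) (a n : ℕ) :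
    ∫ ω, (∑ j ∈ Finset.Ioc a (a + n), (g (X j ω) - ∫ ω', g (X j ω') ∂μ)) ^ 2 ∂μ ≤
      (16 * C ^ 2 + 8 * K) * n / 2 ^ l := by
  have hXm : ∀ j, 1 ≤ j → MemLp (X j) 2 μ := fun j hj =>
    memLp_comp_of_abs_le μ measurable_id (hmeas j) (hbdd j hj)
  have hgm : ∀ j, 1 ≤ j → MemLp (fun ω => g (X j ω)) 2 μ := fun j hj =>
    memLp_comp_of_abs_le μ hg.measurable (hmeas j) (hgb j hj)
  have hgm' : ∀ j ∈ Finset.Ioc a (a + n), MemLp (fun ω => g (X j ω)) 2 μ := fun j hj =>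
    hgm j (by rw [Finset.mem_Ioc] at hj; omega)
  set δ : ℝ := 2 * C / 2 ^ l with hδ
  set c : ℕ → ℝ := fun d => cov[X 1, X (1 + d); μ] with hc
  have hc0 : ∀ d, 0 ≤ c d := fun d =>
    hassoc.covariance_comp_nonneg 1 (1 + d) monotone_id monotone_id (hXm _ le_rfl)
      (hXm _ (by omega))
  set w : ℕ → ℝ := fun d => min (4 * c d) (2 * δ ^ 2) with hw
  have hw0 : ∀ d, 0 ≤ w d := fun d => le_min (by have := hc0 d; positivity) (by positivity)
  have hle : ∀ i d, 1 ≤ i → cov[fun ω => g (X i ω), fun ω => g (X (i + d) ω); μ] ≤ w d := by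
    intro i d hi
    refine le_min ?_ ?_
    · refine (hassoc.covariance_comp_le i (i + d) hg hg' (hXm _ hi) (hXm _ (by omega))
        (hgm _ hi) (hgm _ (by omega))).trans (le_of_eq ?_)
      rw [hstat.covariance_eq hmeas i d hi]
    · exact covariance_le_of_abs_le (hgm _ hi) (hgm _ (by omega)) (hgb _ hi) (hgb _ (by omega))
  have hwsum : ∑ d ∈ Finset.range n, w d ≤ (8 * C ^ 2 + 4 * K) / 2 ^ l := by
    calc ∑ d ∈ Finset.range n, w d ≤ ∑ d ∈ Finset.range (2 ^ l + n), w d :=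
          Finset.sum_le_sum_of_subset_of_nonneg (Finset.range_mono (Nat.le_add_left _ _)) fun d _ _ => hw0 d
      _ = ∑ d ∈ Finset.range (2 ^ l), w d + ∑ d ∈ Finset.range n, w (2 ^ l + d) :=
          Finset.sum_range_add _ _ _
      _ ≤ ∑ d ∈ Finset.range (2 ^ l), 2 * δ ^ 2 + ∑ d ∈ Finset.range n, 4 * c (2 ^ l + d) := by
          gcongr
          · exact min_le_right _ _
          · exact min_le_left _ _
      _ ≤ 2 ^ l * (2 * δ ^ 2) + 4 * (K / 2 ^ l) := by
          have := hK (2 ^ l) n Nat.one_le_two_pow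
          push_cast at this
          rw [Finset.sum_const, Finset.card_range, nsmul_eq_mul, ← Finset.mul_sum]
          push_cast
          exact add_le_add le_rfl (mul_le_mul_of_nonneg_left this (zero_le_four (α := ℝ)))
      _ = (8 * C ^ 2 + 4 * K) / 2 ^ l := by rw [hδ]; field_simp; ring
  have hvar : ∫ ω, (∑ j ∈ Finset.Ioc a (a + n), (g (X j ω) - ∫ ω', g (X j ω') ∂μ)) ^ 2 ∂μ =
      ∑ i ∈ Finset.Ioc a (a + n), ∑ j ∈ Finset.Ioc a (a + n),
        cov[fun ω => g (X i ω), fun ω => g (X j ω); μ] := by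
    rw [← variance_fun_sum' hgm', variance_eq_integral (memLp_finsetSum _ hgm').aemeasurable]
    rw [integral_finsetSum _ fun j hj => (hgm' j hj).integrable one_le_two]
    simp only [Finset.sum_sub_distrib]
  rw [hvar]
  calc _ ≤ ∑ i ∈ Finset.Ioc a (a + n), ∑ j ∈ Finset.Ioc a (a + n), w (Nat.dist i j) := by
        refine Finset.sum_le_sum fun i hi => Finset.sum_le_sum fun j hj => ?_
        rw [Finset.mem_Ioc] at hi hj
        rcases le_total i j with h | h
        · obtain ⟨d, rfl⟩ := Nat.exists_eq_add_of_le h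
          rw [Nat.dist_eq_sub_of_le h, Nat.add_sub_cancel_left]
          exact hle i d (by omega)
        · obtain ⟨d, rfl⟩ := Nat.exists_eq_add_of_le h
          rw [Nat.dist_eq_sub_of_le_right h, Nat.add_sub_cancel_left, covariance_comm]
          exact hle j d (by omega)
    _ ≤ 2 * n * ∑ d ∈ Finset.range n, w d := sum_sum_dist_le w hw0 a n
    _ ≤ 2 * n * ((8 * C ^ 2 + 4 * K) / 2 ^ l) := by gcongr
    _ = _ := by ring

/-- The centered sum `∑_{j=1}^m (|X_j - x| - E|X_j - x|)`. -/
def centeredSum (μ : Measure Ω) (X : ℕ → Ω → ℝ) (x : ℝ) (m : ℕ) (ω : Ω) : ℝ :=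
  ∑ j ∈ Finset.Ioc 0 m, (|X j ω - x| - ∫ ω', |X j ω' - x| ∂μ)

theorem centeredSum_sub (μ : Measure Ω) (X : ℕ → Ω → ℝ) (x : ℝ) (a n : ℕ) (ω : Ω) :
    centeredSum μ X x (a + n) ω - centeredSum μ X x a ω =
      ∑ j ∈ Finset.Ioc a (a + n), (|X j ω - x| - ∫ ω', |X j ω' - x| ∂μ) := by
  unfold centeredSum
  rw [← Finset.sum_Ioc_consecutive _ (Nat.zero_le a) (Nat.le_add_right a n)]
  ring

theorem memLp_abs_sub (μ : Measure Ω) [IsProbabilityMeasure μ] {Y : Ω → ℝ} (hY : Measurable Y)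
    {C : ℝ} (h : ∀ ω, |Y ω| ≤ C) (x : ℝ) : MemLp (fun ω => |Y ω - x|) 2 μ :=
  memLp_comp_of_abs_le μ (g := fun t => |t - x|) (δ := C + |x|) (by fun_prop) hY fun ω => by
    rw [abs_abs]; exact (abs_sub _ _).trans (add_le_add_left (h ω) _)

theorem memLp_centeredSum (μ : Measure Ω) [IsProbabilityMeasure μ]
    {X : ℕ → Ω → ℝ} (hmeas : ∀ j, Measurable (X j))
    {C : ℝ} (hbdd : ∀ n : ℕ, 1 ≤ n → ∀ ω, |X n ω| ≤ C) (x : ℝ) (m : ℕ) :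
    MemLp (centeredSum μ X x m) 2 μ := by
  unfold centeredSum
  refine memLp_finsetSum _ fun j hj => ?_
  exact (memLp_abs_sub μ (hmeas j) (hbdd j (Finset.mem_Ioc.1 hj).1) x).sub (memLp_const _)

theorem abs_centeredSum_sub_le (μ : Measure Ω) [IsProbabilityMeasure μ]
    {X : ℕ → Ω → ℝ} (hmeas : ∀ j, Measurable (X j))
    {C : ℝ} (hbdd : ∀ n : ℕ, 1 ≤ n → ∀ ω, |X n ω| ≤ C) (x y : ℝ) (m : ℕ) (ω : Ω) :
    |centeredSum μ X x m ω - centeredSum μ X y m ω| ≤ m * (2 * |x - y|) := by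
  unfold centeredSum
  rw [← Finset.sum_sub_distrib]
  refine (Finset.abs_sum_le_sum_abs _ _).trans ?_
  have hpt : ∀ t : ℝ, |(|t - x| - |t - y|)| ≤ |x - y| := fun t => by
    refine (abs_abs_sub_abs_le_abs_sub _ _).trans (le_of_eq ?_)
    rw [abs_sub_comm x y]; congr 1; ring
  have : ∀ j ∈ Finset.Ioc 0 m, |(|X j ω - x| - ∫ ω', |X j ω' - x| ∂μ) -
      (|X j ω - y| - ∫ ω', |X j ω' - y| ∂μ)| ≤ 2 * |x - y| := by
    intro j hj
    have hj1 := (Finset.mem_Ioc.1 hj).1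
    have hi : ∀ x, Integrable (fun ω => |X j ω - x|) μ := fun x =>
      (memLp_abs_sub μ (hmeas j) (hbdd j hj1) x).integrable one_le_two
    have h1 : ‖∫ ω', (|X j ω' - x| - |X j ω' - y|) ∂μ‖ ≤ |x - y| := by
      simpa using norm_integral_le_of_norm_le_const (μ := μ)
        (f := fun ω' => |X j ω' - x| - |X j ω' - y|) (.of_forall fun ω' => hpt _)
    rw [integral_sub (hi x) (hi y), Real.norm_eq_abs] at h1
    have h2 := hpt (X j ω)
    rw [abs_le] at h1 h2 ⊢
    constructor <;> linarith [h1.1, h1.2, h2.1, h2.2]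
  refine (Finset.sum_le_sum this).trans (le_of_eq ?_)
  simp

theorem abs_centeredSum_le (μ : Measure Ω) [IsProbabilityMeasure μ]
    {X : ℕ → Ω → ℝ} {C : ℝ} (hbdd : ∀ n : ℕ, 1 ≤ n → ∀ ω, |X n ω| ≤ C) {x : ℝ}
    (hx : |x| ≤ C) (m : ℕ) (ω : Ω) : |centeredSum μ X x m ω| ≤ m * (4 * C) := by
  unfold centeredSum
  refine (Finset.abs_sum_le_sum_abs _ _).trans ?_
  have : ∀ j ∈ Finset.Ioc 0 m, |(|X j ω - x| - ∫ ω', |X j ω' - x| ∂μ)| ≤ 4 * C := by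
    intro j hj
    have hpt : ∀ ω, |X j ω - x| ≤ 2 * C := fun ω =>
      (abs_sub _ _).trans (by linarith [hbdd j (Finset.mem_Ioc.1 hj).1 ω])
    have h1 : ‖∫ ω', |X j ω' - x| ∂μ‖ ≤ 2 * C := by
      simpa using norm_integral_le_of_norm_le_const (μ := μ)
        (f := fun ω' => |X j ω' - x|) (.of_forall fun ω' => by simpa using hpt ω')
    refine (abs_sub _ _).trans ?_
    rw [abs_abs]
    rw [Real.norm_eq_abs] at h1
    linarith [hpt ω]
  refine (Finset.sum_le_sum this).trans (le_of_eq ?_)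
  simp

theorem exists_grid_point {C x : ℝ} (hx : |x| ≤ C) (N : ℕ) :
    ∃ i : ℕ, i ≤ 2 ^ N ∧ |x - (-C + 2 * C * i / 2 ^ N)| ≤ 2 * C / 2 ^ N := by
  have hC : 0 ≤ C := (abs_nonneg x).trans hx
  rw [abs_le] at hx
  rcases hC.eq_or_lt with rfl | hC
  · exact ⟨0, by simp, by simp; linarith [hx.1, hx.2]⟩
  · have hpos : (0 : ℝ) < 2 ^ N := by positivity
    set z : ℝ := (x + C) / (2 * C) * 2 ^ N with hz
    have hz0 : 0 ≤ z := by
      have : 0 ≤ x + C := by linarith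
      positivity
    have hxz : x = -C + 2 * C * z / 2 ^ N := by rw [hz]; field_simp; ring
    refine ⟨⌊z⌋₊, ?_, ?_⟩
    · have : z ≤ 2 ^ N := by
        rw [hz]
        refine mul_le_of_le_one_left hpos.le ?_
        rw [div_le_one (by positivity)]
        linarith
      exact Nat.floor_le_of_le (by exact_mod_cast this)
    · have h1 := Nat.floor_le hz0
      have h2 := Nat.lt_floor_add_one z
      rw [hxz, show -C + 2 * C * z / 2 ^ N - (-C + 2 * C * (⌊z⌋₊ : ℝ) / 2 ^ N) =
        2 * C / 2 ^ N * (z - ⌊z⌋₊) by ring, abs_of_nonneg (by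
          have : 0 ≤ z - ⌊z⌋₊ := by linarith
          positivity)]
      exact mul_le_of_le_one_right (by positivity) (by linarith)

/-- The centered sums sampled on the dyadic grid of level `N` in `[-C, C]`. -/
def gridSum (μ : Measure Ω) (X : ℕ → Ω → ℝ) (C : ℝ) (N m i : ℕ) (ω : Ω) : ℝ :=
  centeredSum μ X (-C + 2 * C * i / 2 ^ N) m ω

theorem abs_centeredSum_le_sqrt_dyadicEnergy (μ : Measure Ω) [IsProbabilityMeasure μ]
    {X : ℕ → Ω → ℝ} (hmeas : ∀ j, Measurable (X j))
    {C : ℝ} (hbdd : ∀ n : ℕ, 1 ≤ n → ∀ ω, |X n ω| ≤ C) {x : ℝ} (hx : |x| ≤ C)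
    (N m : ℕ) (hm : m ≤ 2 ^ N) (ω : Ω) :
    |centeredSum μ X x m ω| ≤
      √(dyadicEnergy N fun m i => gridSum μ X C N m i ω) + 4 * C := by
  obtain ⟨i, hi, hxi⟩ := exists_grid_point hx N
  have h1 : |gridSum μ X C N m i ω| ≤ √(dyadicEnergy N fun m i => gridSum μ X C N m i ω) :=
    Real.abs_le_sqrt (sq_le_dyadicEnergy N (fun m i => gridSum μ X C N m i ω)
      (by simp [gridSum, centeredSum]) m i hm hi)
  have h2 := abs_centeredSum_sub_le μ hmeas hbdd x (-C + 2 * C * i / 2 ^ N) m ω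
  have h3 : (m : ℝ) * (2 * |x - (-C + 2 * C * i / 2 ^ N)|) ≤ 4 * C := by
    calc (m : ℝ) * (2 * |x - (-C + 2 * C * i / 2 ^ N)|) ≤ 2 ^ N * (2 * (2 * C / 2 ^ N)) := by
          gcongr
          exact_mod_cast hm
      _ = 4 * C := by field_simp; ring
  have h4 := abs_sub_abs_le_abs_sub (centeredSum μ X x m ω)
    (centeredSum μ X (-C + 2 * C * i / 2 ^ N) m ω)
  unfold gridSum at h1 ⊢
  linarith

theorem integral_dyadicEnergy_gridSum_le (μ : Measure Ω) [IsProbabilityMeasure μ]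
    (X : ℕ → Ω → ℝ) (hmeas : ∀ j, Measurable (X j))
    (hstat : StrictStationary μ X) (hassoc : IsAssociated μ X)
    (C : ℝ) (hC : 0 ≤ C) (hbdd : ∀ n : ℕ, 1 ≤ n → ∀ ω, |X n ω| ≤ C) (K : ℝ)
    (hK : ∀ n M : ℕ, 1 ≤ n → ∑ d ∈ Finset.range M, cov[X 1, X (1 + (n + d)); μ] ≤ K / n)
    (N : ℕ) :
    Integrable (fun ω => dyadicEnergy N fun m i => gridSum μ X C N m i ω) μ ∧
    ∫ ω, dyadicEnergy N (fun m i => gridSum μ X C N m i ω) ∂μ ≤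
      4 * (16 * C ^ 2 + 8 * K) * (N + 1) ^ 4 * 2 ^ N := by
  refine integral_dyadicEnergy_le μ N (gridSum μ X C N) (16 * C ^ 2 + 8 * K)
    (fun m i => memLp_centeredSum μ hmeas hbdd _ m) ?_ ?_
  · intro r s
    have h := integral_sq_sum_comp_le μ X hmeas hstat hassoc C hbdd K hK 0 (fun t => t + C)
      (fun a b hab => by simpa using hab) (fun a b hab => by dsimp only; linarith)
      (fun j hj ω => by
        have := abs_le.1 (hbdd j hj ω)
        rw [abs_le]; constructor <;> simp <;> linarith) (s * 2 ^ r) (2 ^ r)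
    have habs : ∀ j, 1 ≤ j → ∀ ω, |X j ω - -C| = X j ω + C := fun j hj ω => by
      have := abs_le.1 (hbdd j hj ω)
      rw [sub_neg_eq_add, abs_of_nonneg (by linarith)]
    refine le_trans (le_of_eq ?_) (h.trans (le_of_eq (by simp)))
    congr 1
    ext ω
    congr 1
    unfold gridSum
    rw [add_mul, one_mul, centeredSum_sub]
    refine Finset.sum_congr rfl fun j hj => ?_
    have hj1 : 1 ≤ j := by rw [Finset.mem_Ioc] at hj; omega
    have h0 : -C + 2 * C * ((0 : ℕ) : ℝ) / 2 ^ N = -C := by simp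
    simp only [h0, habs j hj1]
  · intro r s q t hq ht
    set x : ℝ := -C + 2 * C * ((t * 2 ^ q : ℕ) : ℝ) / 2 ^ N with hx
    set y : ℝ := -C + 2 * C * (((t + 1) * 2 ^ q : ℕ) : ℝ) / 2 ^ N with hy
    have hyx : y - x = 2 * C / 2 ^ (N - q) := by
      rw [hx, hy, show (2 : ℝ) ^ N = 2 ^ (N - q) * 2 ^ q by rw [← pow_add, Nat.sub_add_cancel hq]]
      push_cast
      field_simp
      ring
    have hxy : x ≤ y := by
      have : 0 ≤ 2 * C / 2 ^ (N - q) := by positivity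
      linarith
    have h := integral_sq_sum_comp_le μ X hmeas hstat hassoc C hbdd K hK (N - q)
      (fun t => |t - x| - |t - y|)
      (fun a b hab => by
        dsimp only
        rcases abs_cases (a - x) with h1 | h1 <;> rcases abs_cases (b - x) with h2 | h2 <;>
          rcases abs_cases (a - y) with h3 | h3 <;> rcases abs_cases (b - y) with h4 | h4 <;>
          linarith)
      (fun a b hab => by
        dsimp only
        rcases abs_cases (a - x) with h1 | h1 <;> rcases abs_cases (b - x) with h2 | h2 <;>
          rcases abs_cases (a - y) with h3 | h3 <;> rcases abs_cases (b - y) with h4 | h4 <;>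
          linarith)
      (fun j hj ω => by
        rw [← hyx, ← abs_of_nonneg (sub_nonneg.2 hxy)]
        refine (abs_abs_sub_abs_le_abs_sub _ _).trans (le_of_eq ?_)
        congr 1; ring) (s * 2 ^ r) (2 ^ r)
    refine le_trans (le_of_eq ?_) (h.trans (le_of_eq (by push_cast; rfl)))
    congr 1
    ext ω
    rw [← neg_sq]
    congr 1
    unfold gridSum
    rw [← hx, ← hy, add_mul s, one_mul, centeredSum_sub, centeredSum_sub, neg_sub,
      ← Finset.sum_sub_distrib]
    refine Finset.sum_congr rfl fun j hj => ?_
    have hj1 : 1 ≤ j := by rw [Finset.mem_Ioc] at hj; omega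
    have hi : ∀ x, Integrable (fun ω => |X j ω - x|) μ := fun x =>
      (memLp_abs_sub μ (hmeas j) (hbdd j hj1) x).integrable one_le_two
    rw [integral_sub (hi x) (hi y)]
    ring

theorem ae_tendsto_zero_of_summable_integral (μ : Measure Ω) (q : ℕ → Ω → ℝ)
    (hq : ∀ N, Integrable (q N) μ) (hq0 : ∀ N ω, 0 ≤ q N ω)
    (hs : Summable fun N => ∫ ω, q N ω ∂μ) :
    ∀ᵐ ω ∂μ, Tendsto (fun N => q N ω) atTop (𝓝 0) := by
  have hm : ∀ N, AEMeasurable (fun ω => ENNReal.ofReal (q N ω)) μ := fun N =>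
    (hq N).aemeasurable.ennreal_ofReal
  have hfin : ∫⁻ ω, ∑' N, ENNReal.ofReal (q N ω) ∂μ ≠ ⊤ := by
    rw [lintegral_tsum hm]
    simp_rw [← fun N => ofReal_integral_eq_lintegral_ofReal (hq N) (.of_forall (hq0 N))]
    exact hs.tsum_ofReal_ne_top
  filter_upwards [ae_lt_top' (AEMeasurable.tsum hm) hfin] with ω hω
  have h := ENNReal.tendsto_atTop_zero_of_tsum_ne_top hω.ne
  have h2 := (ENNReal.tendsto_toReal ENNReal.zero_ne_top).comp h
  refine Tendsto.congr (fun N => ?_) h2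
  simp [ENNReal.toReal_ofReal (hq0 N ω)]

theorem sum_range_covariance_le (μ : Measure Ω) [IsProbabilityMeasure μ]
    (X : ℕ → Ω → ℝ) (hmeas : ∀ j, Measurable (X j)) (hassoc : IsAssociated μ X)
    (C : ℝ) (hbdd : ∀ n : ℕ, 1 ≤ n → ∀ ω, |X n ω| ≤ C) (k : ℕ) (hk : 4 ≤ k)
    (hsum : Summable fun j : ℕ => cov μ (X 1) (X (j + 2))) (K : ℝ)
    (hcov : ∀ n : ℕ, 1 ≤ n →
      ∑' i : ℕ, cov μ (X 1) (X (n + 1 + i)) ≤ K * (n : ℝ) ^ (-(((k : ℝ) - 2) / 2)))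
    (n M : ℕ) (hn : 1 ≤ n) :
    ∑ d ∈ Finset.range M, cov[X 1, X (1 + (n + d)); μ] ≤ |K| / n := by
  have hXm : ∀ j, 1 ≤ j → MemLp (X j) 2 μ := fun j hj =>
    memLp_comp_of_abs_le μ measurable_id (hmeas j) (hbdd j hj)
  have heq : ∀ j, 1 ≤ j → cov μ (X 1) (X j) = cov[X 1, X j; μ] := fun j hj =>
    cov_eq_covariance μ (hXm 1 le_rfl) (hXm j hj)
  have hpos : ∀ j, 1 ≤ j → 0 ≤ cov μ (X 1) (X j) := fun j hj => by
    rw [heq j hj]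
    exact hassoc.covariance_comp_nonneg 1 j monotone_id monotone_id (hXm _ le_rfl) (hXm _ hj)
  have hs : Summable fun i : ℕ => cov μ (X 1) (X (n + 1 + i)) := by
    refine ((summable_nat_add_iff (n - 1)).2 hsum).congr fun i => ?_
    rw [show i + (n - 1) + 2 = n + 1 + i by omega]
  have hn' : (1 : ℝ) ≤ n := by exact_mod_cast hn
  have hk' : (4 : ℝ) ≤ k := by exact_mod_cast hk
  calc ∑ d ∈ Finset.range M, cov[X 1, X (1 + (n + d)); μ]
      = ∑ d ∈ Finset.range M, cov μ (X 1) (X (n + 1 + d)) :=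
        Finset.sum_congr rfl fun d _ => by
          rw [← heq _ (by omega), show 1 + (n + d) = n + 1 + d by ring]
    _ ≤ ∑' i : ℕ, cov μ (X 1) (X (n + 1 + i)) :=
        hs.sum_le_tsum _ fun d _ => hpos _ (by omega)
    _ ≤ K * (n : ℝ) ^ (-(((k : ℝ) - 2) / 2)) := hcov n hn
    _ ≤ |K| * (n : ℝ) ^ (-1 : ℝ) := by
        gcongr
        · exact le_abs_self K
        · linarith
    _ = |K| / n := by rw [Real.rpow_neg_one, div_eq_mul_inv]

theorem summable_succ_pow_mul_geometric {r : ℝ} (hr0 : 0 < r) (hr1 : r < 1) (k : ℕ) :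
    Summable fun N : ℕ => ((N : ℝ) + 1) ^ k * r ^ N := by
  have h0 : Summable fun N : ℕ => (N : ℝ) ^ k * r ^ N :=
    summable_pow_mul_geometric_of_norm_lt_one k (by rwa [Real.norm_of_nonneg hr0.le])
  have h := (summable_nat_add_iff 1).2 h0
  refine (h.mul_right r⁻¹).congr fun N => ?_
  push_cast
  rw [pow_succ r]
  field_simp

/-- If the covariance tails are of order `1 / n`, the uniform centered sums are almost surely
of smaller order than `n ^ α` for every `α > 1 / 2`. -/
theorem ae_tendsto_iSup_centeredSum_div_rpow (μ : Measure Ω) [IsProbabilityMeasure μ]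
    (X : ℕ → Ω → ℝ) (hmeas : ∀ j, Measurable (X j))
    (hstat : StrictStationary μ X) (hassoc : IsAssociated μ X)
    (C : ℝ) (hC : 0 ≤ C) (hbdd : ∀ n : ℕ, 1 ≤ n → ∀ ω, |X n ω| ≤ C) (K : ℝ)
    (hK : ∀ n M : ℕ, 1 ≤ n → ∑ d ∈ Finset.range M, cov[X 1, X (1 + (n + d)); μ] ≤ K / n)
    (α : ℝ) (hα : 1 / 2 < α) :
    ∀ᵐ ω ∂μ, Tendsto (fun n : ℕ =>
      (⨆ x : Set.Icc (-C) C, |centeredSum μ X x n ω|) / (n : ℝ) ^ α) atTop (𝓝 0) := by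
  set T : ℝ := 2 ^ α with hT
  have hT0 : 0 < T := by positivity
  have hT2 : 2 < T ^ 2 := by
    rw [hT, ← Real.rpow_natCast, ← Real.rpow_mul (by norm_num)]
    calc (2 : ℝ) = 2 ^ (1 : ℝ) := (Real.rpow_one 2).symm
      _ < _ := Real.rpow_lt_rpow_of_exponent_lt (by norm_num) (by push_cast; linarith)
  set E : ℕ → Ω → ℝ := fun N ω => dyadicEnergy N fun m i => gridSum μ X C N m i ω with hE
  have hEint := integral_dyadicEnergy_gridSum_le μ X hmeas hstat hassoc C hC hbdd K hK
  have hE0 : ∀ N ω, 0 ≤ E N ω := fun N ω => dyadicEnergy_nonneg _ _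
  have hae := ae_tendsto_zero_of_summable_integral μ (fun N ω => E N ω / (T ^ 2) ^ N)
    (fun N => (hEint N).1.div_const _)
    (fun N ω => div_nonneg (hE0 N ω) (by positivity)) (by
      have hs := (summable_succ_pow_mul_geometric (r := 2 / T ^ 2) (by positivity)
        (by rw [div_lt_one (by positivity)]; exact hT2) 4).mul_left (4 * (16 * C ^ 2 + 8 * K))
      refine Summable.of_nonneg_of_le
        (fun N => integral_nonneg fun ω => div_nonneg (hE0 N ω) (by positivity)) (fun N => ?_) hs
      rw [integral_div, div_le_iff₀ (by positivity)]
      refine (hEint N).2.trans (le_of_eq ?_)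
      rw [div_pow]
      field_simp)
  filter_upwards [hae] with ω hω
  have hlog : Tendsto (fun n : ℕ => Nat.log 2 n + 1) atTop atTop := by
    refine tendsto_atTop_atTop.2 fun b => ⟨2 ^ b, fun n hn => ?_⟩
    exact (Nat.le_log_of_pow_le one_lt_two hn).trans (Nat.le_succ _)
  have h1 : Tendsto (fun n : ℕ => T * √(E (Nat.log 2 n + 1) ω / (T ^ 2) ^ (Nat.log 2 n + 1)))
      atTop (𝓝 0) := by
    simpa using ((hω.comp hlog).sqrt).const_mul T
  have h2 : Tendsto (fun n : ℕ => 4 * C / (n : ℝ) ^ α) atTop (𝓝 0) :=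
    tendsto_const_nhds.div_atTop
      ((tendsto_rpow_atTop (by linarith)).comp tendsto_natCast_atTop_atTop)
  have h12 := h1.add h2
  rw [add_zero] at h12
  refine squeeze_zero' (.of_forall fun n => div_nonneg
    (Real.iSup_nonneg fun x => abs_nonneg _) (by positivity)) ?_ h12
  filter_upwards [eventually_ge_atTop 1] with n hn
  set N := Nat.log 2 n with hN
  have hnα : 0 < (n : ℝ) ^ α := Real.rpow_pos_of_pos (by exact_mod_cast hn) _
  have hsup : (⨆ x : Set.Icc (-C) C, |centeredSum μ X x n ω|) ≤ √(E (N + 1) ω) + 4 * C :=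
    Real.iSup_le (fun x => abs_centeredSum_le_sqrt_dyadicEnergy μ hmeas hbdd
      (abs_le.2 x.2) (N + 1) n (Nat.lt_pow_succ_log_self one_lt_two n).le ω) (by positivity)
  have hTn : T ^ N ≤ (n : ℝ) ^ α := by
    rw [hT, ← Real.rpow_natCast, ← Real.rpow_mul (by norm_num), mul_comm,
      Real.rpow_mul (by norm_num), Real.rpow_natCast]
    refine Real.rpow_le_rpow (by positivity) ?_ (by linarith)
    exact_mod_cast Nat.pow_log_le_self 2 (by omega)
  refine (div_le_div_of_nonneg_right hsup hnα.le).trans ?_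
  rw [add_div]
  refine add_le_add ?_ le_rfl
  calc √(E (N + 1) ω) / (n : ℝ) ^ α ≤ √(E (N + 1) ω) / T ^ N := by gcongr
    _ = T * √(E (N + 1) ω / (T ^ 2) ^ (N + 1)) := by
      rw [Real.sqrt_div (hE0 _ _), ← pow_mul, mul_comm 2, pow_mul,
        Real.sqrt_sq (by positivity), pow_succ]
      field_simp

/-- **Theorem 4.2**: uniform strong law for `∑_{j=1}^n (|X_j − x| − E|X_j − x|)` over
`x ∈ [−C₁, C₁]`, normalized by `b_n` of exact order `n^{1+u/2−p}` with `u > 1`,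
`p ∈ (0,1)` and `(k/2)(1+u) − (k+1)p > 1`, under the covariance decay
`∑_{j=n+1}^∞ Cov(X₁, Xⱼ) = O(n^{−(k−2)/2})`. -/
theorem uniform_strong_law (μ : Measure Ω) [IsProbabilityMeasure μ]
    (X : ℕ → Ω → ℝ) (hmeas : ∀ j, Measurable (X j))
    (hstat : StrictStationary μ X) (hassoc : IsAssociated μ X)
    (C₁ : ℝ) (hbdd : ∀ n : ℕ, 1 ≤ n → ∀ ω, |X n ω| ≤ C₁)
    (k : ℕ) (hk : 2 < k)
    (hsum : Summable fun j : ℕ => cov μ (X 1) (X (j + 2)))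
    (hcov : ∃ K : ℝ, ∀ n : ℕ, 1 ≤ n →
      ∑' i : ℕ, cov μ (X 1) (X (n + 1 + i)) ≤ K * (n : ℝ) ^ (-(((k : ℝ) - 2) / 2)))
    (u p : ℝ) (hu : 1 < u) (hp0 : 0 < p) (hp1 : p < 1)
    (hkup : 1 < (k : ℝ) / 2 * (1 + u) - ((k : ℝ) + 1) * p)
    (b : ℕ → ℝ) (c₁ c₂ : ℝ) (hc₁ : 0 < c₁)
    (hb : ∀ n : ℕ, 1 ≤ n →
      c₁ * (n : ℝ) ^ (1 + u / 2 - p) ≤ b n ∧ b n ≤ c₂ * (n : ℝ) ^ (1 + u / 2 - p)) :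
    ∀ᵐ ω ∂μ, Tendsto (fun n : ℕ =>
        (⨆ x : Set.Icc (-C₁) C₁,
          |∑ j ∈ Finset.Icc 1 n, (|X j ω - (x : ℝ)| - ∫ ω', |X j ω' - (x : ℝ)| ∂μ)|) / b n)
      atTop (𝓝 0) := by
  obtain ⟨K, hK⟩ := hcov
  obtain ⟨ω₀⟩ : Nonempty Ω := nonempty_of_isProbabilityMeasure μ
  have hC : 0 ≤ C₁ := (abs_nonneg _).trans (hbdd 1 le_rfl ω₀)
  set α : ℝ := 1 + u / 2 - p with hα
  have hα0 : 1 / 2 < α := by linarith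
  have main : ∀ᵐ ω ∂μ, Tendsto (fun n : ℕ =>
      (⨆ x : Set.Icc (-C₁) C₁, |centeredSum μ X x n ω|) / (n : ℝ) ^ α) atTop (𝓝 0) := by
    rcases le_or_gt α 1 with hα1 | hα1
    · have hk4 : 4 ≤ k := by
        by_contra hlt
        obtain rfl : k = 3 := by omega
        norm_num at hkup
        linarith
      exact ae_tendsto_iSup_centeredSum_div_rpow μ X hmeas hstat hassoc C₁ hC hbdd |K|
        (sum_range_covariance_le μ X hmeas hassoc C₁ hbdd k hk4 hsum K hK) α hα0
    · refine .of_forall fun ω => ?_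
      have h : Tendsto (fun n : ℕ => 4 * C₁ / (n : ℝ) ^ (α - 1)) atTop (𝓝 0) :=
        tendsto_const_nhds.div_atTop
          ((tendsto_rpow_atTop (by linarith)).comp tendsto_natCast_atTop_atTop)
      refine squeeze_zero' (.of_forall fun n => div_nonneg
        (Real.iSup_nonneg fun x => abs_nonneg _) (by positivity)) ?_ h
      filter_upwards [eventually_ge_atTop 1] with n hn
      have hn0 : (0 : ℝ) < n := by exact_mod_cast hn
      have hsup : (⨆ x : Set.Icc (-C₁) C₁, |centeredSum μ X x n ω|) ≤ n * (4 * C₁) :=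
        Real.iSup_le (fun x => abs_centeredSum_le μ hbdd (abs_le.2 x.2) n ω) (by positivity)
      refine (div_le_div_of_nonneg_right hsup (by positivity)).trans (le_of_eq ?_)
      rw [Real.rpow_sub_one hn0.ne']
      field_simp
  filter_upwards [main] with ω hω
  have h := hω.div_const c₁
  rw [zero_div] at h
  refine squeeze_zero' ?_ ?_ h
  all_goals
    filter_upwards [eventually_ge_atTop 1] with n hn
    have hnα : 0 < (n : ℝ) ^ α := Real.rpow_pos_of_pos (by exact_mod_cast hn) _
    have hbn := (hb n hn).1
    have hsup : 0 ≤ ⨆ x : Set.Icc (-C₁) C₁, |centeredSum μ X x n ω| :=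
      Real.iSup_nonneg fun x => abs_nonneg _
  · exact div_nonneg hsup ((by positivity : 0 ≤ c₁ * (n : ℝ) ^ α).trans hbn)
  · rw [div_div, mul_comm _ c₁]
    exact div_le_div_of_nonneg_left hsup (by positivity) hbn
end
end

section
/- Let {X_n, n ≥ 1} be a strictly stationary sequence of associated random variables with |X_n| ≤ C_1 < ∞ for all n and such that each X_i has a bounded continuous density. Fix s, t ∈ ℝ and a positive integer k, let Y_{i,i+k} = I(X_i ≤ s, X_{i+k} ≤ t), and define the histogram estimator U_n(s,t) = (1/(n−k)) Σ_{i=1}^{n−k} Y_{i,i+k}. Assume Σ_{j=1}^∞ Cov(X_1, X_j)^δ < ∞ for some 0 < δ < 1/2, and that σ² = Var(Y_{1,1+k}) + 2 Σ_{j=2}^∞ Cov(Y_{1,1+k}, Y_{j,j+k}) satisfies 0 < σ² < ∞. Then √(n−k) ( U_n(s,t) − P(X_1 ≤ s, X_{k+1} ≤ t) ) / σ converges in distribution to N(0,1) as n → ∞. -/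
open MeasureTheory ProbabilityTheory Filter Topology

noncomputable section

variable {Ω : Type*} [MeasurableSpace Ω]

/-- The indicator variable `Y_{i,i+k} = I(X_i ≤ s, X_{i+k} ≤ t)`. -/
def Yind (X : ℕ → Ω → ℝ) (k : ℕ) (s t : ℝ) (i : ℕ) (ω : Ω) : ℝ :=
  Set.indicator {ω' | X i ω' ≤ s ∧ X (i + k) ω' ≤ t} (fun _ => (1 : ℝ)) ω

/-- `X` has a bounded continuous probability density (w.r.t. Lebesgue measure). -/
def HasBddContDensity (μ : Measure Ω) (X : Ω → ℝ) : Prop :=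
  ∃ d : ℝ → ℝ, Continuous d ∧ (∃ M : ℝ, ∀ x, d x ≤ M) ∧ (∀ x, 0 ≤ d x) ∧
    μ.map X = volume.withDensity (fun x => ENNReal.ofReal (d x))

lemma cov_eq_covariance_s16 {μ : Measure Ω} [IsProbabilityMeasure μ] {S T : Ω → ℝ}
    (hS : MemLp S 2 μ) (hT : MemLp T 2 μ) : cov μ S T = covariance S T μ :=
  (covariance_eq_sub hS hT).symm

lemma memLp_comp_of_continuous_of_bounded {μ : Measure Ω} [IsFiniteMeasure μ] {S : Ω → ℝ}
    (hS : Measurable S) {A : ℝ} (hA : ∀ ω, |S ω| ≤ A) {f : ℝ → ℝ} (hf : Continuous f)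
    (p : ENNReal) : MemLp (fun ω => f (S ω)) p μ := by
  obtain ⟨C, hC⟩ := (isCompact_Icc (a := -A) (b := A)).exists_bound_of_continuousOn
    hf.continuousOn
  exact .of_bound (hf.measurable.comp hS).aestronglyMeasurable C
    (.of_forall fun ω => hC _ (abs_le.1 (hA ω)))

lemma integral_cexp_mul_I {μ : Measure Ω} [IsFiniteMeasure μ] {U : Ω → ℝ} (hU : Measurable U) :
    ∫ ω, Complex.exp (U ω * Complex.I) ∂μ =
      (∫ ω, Real.cos (U ω) ∂μ : ℝ) + (∫ ω, Real.sin (U ω) ∂μ : ℝ) * Complex.I := by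
  have hc : Integrable (fun ω => Real.cos (U ω)) μ :=
    .of_bound (by fun_prop) 1 (.of_forall fun ω => Real.abs_cos_le_one _)
  have hs : Integrable (fun ω => Real.sin (U ω)) μ :=
    .of_bound (by fun_prop) 1 (.of_forall fun ω => Real.abs_sin_le_one _)
  rw [← integral_complex_ofReal, ← integral_complex_ofReal, ← integral_mul_const,
    ← integral_add hc.ofReal (hs.ofReal.mul_const _)]
  simp [Complex.exp_mul_I]

/-- The pair `(S, T)` is positively quadrant dependent in the sense of covariances of continuous
nondecreasing functions. -/
def PositivelyDependent (μ : Measure Ω) (S T : Ω → ℝ) : Prop :=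
  ∀ f g : ℝ → ℝ, Continuous f → Continuous g → Monotone f → Monotone g →
    0 ≤ cov μ (fun ω => f (S ω)) (fun ω => g (T ω))

lemma LipschitzWith.monotone_mul_add {f : ℝ → ℝ} {a : NNReal} (hf : LipschitzWith a f) :
    Monotone fun x => (a : ℝ) * x + f x := by
  intro x y hxy
  have := hf.dist_le_mul x y
  rw [Real.dist_eq, Real.dist_eq, abs_of_nonpos (sub_nonpos.2 hxy)] at this
  have := (abs_le.1 this).2
  dsimp only
  linarith

lemma PositivelyDependent.abs_covariance_comp_le {μ : Measure Ω} [IsProbabilityMeasure μ]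
    {S T : Ω → ℝ} (h : PositivelyDependent μ S T) (hS : Measurable S) (hT : Measurable T)
    {A B : ℝ} (hA : ∀ ω, |S ω| ≤ A) (hB : ∀ ω, |T ω| ≤ B) {f g : ℝ → ℝ} {a : NNReal}
    (hf : LipschitzWith a f) (hg : LipschitzWith a g) :
    |covariance (fun ω => f (S ω)) (fun ω => g (T ω)) μ| ≤ a ^ 2 * covariance S T μ := by
  have hcf := hf.continuous
  have hcg := hg.continuous
  have key : ∀ f' g' : ℝ → ℝ, LipschitzWith a f' → LipschitzWith a g' →
      0 ≤ a ^ 2 * covariance S T μ + a * covariance S (fun ω => g' (T ω)) μ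
        + a * covariance (fun ω => f' (S ω)) T μ
        + covariance (fun ω => f' (S ω)) (fun ω => g' (T ω)) μ := by
    intro f' g' hf' hg'
    have hcf' := hf'.continuous
    have hcg' := hg'.continuous
    have h1 : MemLp (fun ω => (a : ℝ) * S ω) 2 μ :=
      memLp_comp_of_continuous_of_bounded hS hA (f := fun x => a * x) (by fun_prop) 2
    have h2 : MemLp (fun ω => (a : ℝ) * T ω) 2 μ :=
      memLp_comp_of_continuous_of_bounded hT hB (f := fun x => a * x) (by fun_prop) 2
    have h3 := memLp_comp_of_continuous_of_bounded (μ := μ) hS hA hcf' 2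
    have h4 := memLp_comp_of_continuous_of_bounded (μ := μ) hT hB hcg' 2
    have := h _ _ (by fun_prop) (by fun_prop) hf'.monotone_mul_add hg'.monotone_mul_add
    change 0 ≤ cov μ ((fun ω => (a : ℝ) * S ω) + fun ω => f' (S ω))
      ((fun ω => (a : ℝ) * T ω) + fun ω => g' (T ω)) at this
    rw [cov_eq_covariance_s16 (h1.add h3) (h2.add h4), covariance_add_left h1 h3 (h2.add h4),
      covariance_add_right h1 h2 h4,
      covariance_add_right h3 h2 h4, covariance_const_mul_left, covariance_const_mul_right,
      covariance_const_mul_left, covariance_const_mul_right] at this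
    linarith
  have h1 := key f g hf hg
  have h2 := key _ _ hf.neg hg
  have h3 := key _ _ hf hg.neg
  have h4 := key _ _ hf.neg hg.neg
  simp only [Pi.neg_apply, covariance_fun_neg_left, covariance_fun_neg_right] at h2 h3 h4
  rw [abs_le]
  constructor <;> linarith

/-- Newman's inequality for the characteristic function of a sum of two variables. -/
lemma PositivelyDependent.norm_integral_cexp_add_sub_le {μ : Measure Ω} [IsProbabilityMeasure μ]
    {S T : Ω → ℝ} (h : PositivelyDependent μ S T) (hS : Measurable S) (hT : Measurable T)
    {A B : ℝ} (hA : ∀ ω, |S ω| ≤ A) (hB : ∀ ω, |T ω| ≤ B) (r : ℝ) :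
    ‖∫ ω, Complex.exp ((r * (S ω + T ω) : ℝ) * Complex.I) ∂μ -
      (∫ ω, Complex.exp ((r * S ω : ℝ) * Complex.I) ∂μ) *
        ∫ ω, Complex.exp ((r * T ω : ℝ) * Complex.I) ∂μ‖ ≤ 4 * r ^ 2 * covariance S T μ := by
  have hr : LipschitzWith ‖r‖₊ (fun x : ℝ => r * x) := lipschitzWith_smul r
  have hcos : LipschitzWith ‖r‖₊ (fun x => Real.cos (r * x)) := by
    simpa using! Real.lipschitzWith_cos.comp hr
  have hsin : LipschitzWith ‖r‖₊ (fun x => Real.sin (r * x)) := by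
    simpa using! Real.lipschitzWith_sin.comp hr
  have hcc := h.abs_covariance_comp_le hS hT hA hB hcos hcos
  have hcs := h.abs_covariance_comp_le hS hT hA hB hcos hsin
  have hsc := h.abs_covariance_comp_le hS hT hA hB hsin hcos
  have hss := h.abs_covariance_comp_le hS hT hA hB hsin hsin
  have mcS := memLp_comp_of_continuous_of_bounded (μ := μ) hS hA hcos.continuous 2
  have msS := memLp_comp_of_continuous_of_bounded (μ := μ) hS hA hsin.continuous 2
  have mcT := memLp_comp_of_continuous_of_bounded (μ := μ) hT hB hcos.continuous 2
  have msT := memLp_comp_of_continuous_of_bounded (μ := μ) hT hB hsin.continuous 2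
  rw [integral_cexp_mul_I (by fun_prop), integral_cexp_mul_I (by fun_prop),
    integral_cexp_mul_I (by fun_prop)]
  simp_rw [fun ω => mul_add r (S ω) (T ω), Real.cos_add, Real.sin_add]
  have icc : Integrable (fun ω => Real.cos (r * S ω) * Real.cos (r * T ω)) μ :=
    mcS.integrable_mul mcT
  have ics : Integrable (fun ω => Real.cos (r * S ω) * Real.sin (r * T ω)) μ :=
    mcS.integrable_mul msT
  have isc : Integrable (fun ω => Real.sin (r * S ω) * Real.cos (r * T ω)) μ :=
    msS.integrable_mul mcT
  have iss : Integrable (fun ω => Real.sin (r * S ω) * Real.sin (r * T ω)) μ :=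
    msS.integrable_mul msT
  rw [integral_sub icc iss, integral_add isc ics]
  rw [covariance_eq_sub mcS mcT] at hcc
  rw [covariance_eq_sub mcS msT] at hcs
  rw [covariance_eq_sub msS mcT] at hsc
  rw [covariance_eq_sub msS msT] at hss
  simp only [Pi.mul_apply, coe_nnnorm, Real.norm_eq_abs, sq_abs] at hcc hcs hsc hss
  refine (Complex.norm_le_abs_re_add_abs_im _).trans ?_
  simp only [Complex.sub_re, Complex.sub_im, Complex.add_re, Complex.add_im, Complex.mul_re,
    Complex.mul_im, Complex.ofReal_re, Complex.ofReal_im, Complex.I_re, Complex.I_im]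
  rw [abs_le] at hcc hcs hsc hss
  refine (add_le_add (abs_le.2 ⟨?_, ?_⟩ : _ ≤ 2 * r ^ 2 * covariance S T μ)
    (abs_le.2 ⟨?_, ?_⟩ : _ ≤ 2 * r ^ 2 * covariance S T μ)).trans (by linarith) <;> linarith

lemma norm_pow_sub_pow_le_mul {a b : ℂ} (ha : ‖a‖ ≤ 1) (hb : ‖b‖ ≤ 1) (n : ℕ) :
    ‖a ^ n - b ^ n‖ ≤ n * ‖a - b‖ := by
  induction n with
  | zero => simp
  | succ n ih =>
    calc ‖a ^ (n + 1) - b ^ (n + 1)‖ = ‖(a ^ n - b ^ n) * a + b ^ n * (a - b)‖ := by ring_nf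
      _ ≤ ‖a ^ n - b ^ n‖ * ‖a‖ + ‖b‖ ^ n * ‖a - b‖ := by
        refine (norm_add_le _ _).trans_eq ?_
        simp
      _ ≤ (n * ‖a - b‖) * 1 + 1 * ‖a - b‖ := by
        gcongr
        exact pow_le_one₀ (norm_nonneg _) hb
      _ = _ := by push_cast; ring

/-- The characteristic function of a centered square-integrable variable agrees up to second order
with that of the Gaussian with the same variance. -/
lemma charFun_sub_charFun_gaussianReal_isLittleO {μ : Measure Ω} [IsProbabilityMeasure μ]
    {S : Ω → ℝ} (hS : Measurable S) (h2 : MemLp S 2 μ) (h0 : ∫ ω, S ω ∂μ = 0) {v : NNReal}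
    (hv : variance S μ = v) :
    (fun t => charFun (μ.map S) t - charFun (gaussianReal 0 v) t) =o[𝓝 0] fun t => t ^ 2 := by
  have : IsProbabilityMeasure (μ.map S) := Measure.isProbabilityMeasure_map hS.aemeasurable
  have hS2 : ∫ ω, (S ^ 2) ω ∂μ = v := by
    rw [← hv, variance_eq_sub h2, h0]
    simp
  have hG2 : ∫ x, ((id : ℝ → ℝ) ^ 2) x ∂(gaussianReal 0 v) = v := by
    have := variance_eq_sub (memLp_id_gaussianReal (μ := 0) (v := v) 2)
    rw [variance_id_gaussianReal] at this
    rw [this]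
    simp
  have mS : MemLp id 2 (μ.map S) := by
    rw [memLp_map_measure_iff (by fun_prop) (by fun_prop)]
    exact h2
  have mG : MemLp id 2 ((gaussianReal 0 v).map id) := by
    rw [Measure.map_id]
    exact memLp_id_gaussianReal 2
  have eS := taylor_isLittleO_univ (x₀ := 0) (contDiff_charFun (n := 2) mS)
  have eG := taylor_isLittleO_univ (x₀ := 0) (contDiff_charFun (n := 2) mG)
  simp_rw [taylorWithinEval_charFun_two_zero hS.aemeasurable mS] at eS
  simp_rw [taylorWithinEval_charFun_two_zero aemeasurable_id mG] at eG
  rw [hS2, h0] at eS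
  rw [hG2] at eG
  convert! eS.sub eG using 2 with t t
  · simp
  · simp

lemma tendsto_natCast_div_div_natCast {l : ℕ} :
    Tendsto (fun n : ℕ => ((n / l : ℕ) : ℝ) / n) atTop (𝓝 (l : ℝ)⁻¹) := by
  have := (tendsto_nat_floor_mul_div_atTop (R := ℝ) (inv_nonneg.2 l.cast_nonneg)).comp
    tendsto_natCast_atTop_atTop
  refine this.congr fun n => ?_
  simp only [Function.comp_apply]
  rw [inv_mul_eq_div, Nat.floor_div_natCast, Nat.floor_natCast]

/-- If `S` is centered, then the sum of `n / l` independent copies of `S`, normalized by `√n`,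
converges in distribution to a centered Gaussian, in terms of characteristic functions. -/
lemma tendsto_charFun_div_sqrt_pow_div {μ : Measure Ω} [IsProbabilityMeasure μ]
    {S : Ω → ℝ} (hS : Measurable S) (h2 : MemLp S 2 μ) (h0 : ∫ ω, S ω ∂μ = 0) (l : ℕ) (r : ℝ) :
    Tendsto (fun n : ℕ => charFun (μ.map S) (r / √n) ^ (n / l)) atTop
      (𝓝 (Complex.exp (-(r ^ 2 * (variance S μ / l) / 2) : ℝ))) := by
  have : IsProbabilityMeasure (μ.map S) := Measure.isProbabilityMeasure_map hS.aemeasurable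
  obtain ⟨v, hv⟩ : ∃ v : NNReal, variance S μ = v := ⟨⟨_, variance_nonneg S μ⟩, rfl⟩
  have hr : Tendsto (fun n : ℕ => r / √n) atTop (𝓝 0) :=
    tendsto_const_nhds.div_atTop (Real.tendsto_sqrt_atTop.comp tendsto_natCast_atTop_atTop)
  have hsq : ∀ᶠ n : ℕ in atTop, (r / √n) ^ 2 = r ^ 2 / n :=
    .of_forall fun n => by rw [div_pow, Real.sq_sqrt n.cast_nonneg]
  have hgauss : Tendsto (fun n : ℕ => charFun (gaussianReal 0 v) (r / √n) ^ (n / l)) atTop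
      (𝓝 (Complex.exp (-(r ^ 2 * (variance S μ / l) / 2) : ℝ))) := by
    have h1 : Tendsto (fun n : ℕ => -(r ^ 2 * v / 2 * (((n / l : ℕ) : ℝ) / n))) atTop
        (𝓝 (-(r ^ 2 * (variance S μ / l) / 2))) := by
      convert! (tendsto_natCast_div_div_natCast.const_mul (r ^ 2 * v / 2)).neg using 2
      rw [hv]
      ring
    refine ((Complex.continuous_exp.comp Complex.continuous_ofReal).continuousAt.tendsto.comp
      h1).congr' ?_
    filter_upwards [hsq] with n hn
    rw [charFun_gaussianReal, ← Complex.exp_nat_mul]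
    simp only [Function.comp_apply]
    congr 1
    rw [← Complex.ofReal_pow, hn]
    push_cast
    ring
  have hdiff : Tendsto (fun n : ℕ => charFun (μ.map S) (r / √n) ^ (n / l) -
      charFun (gaussianReal 0 v) (r / √n) ^ (n / l)) atTop (𝓝 0) := by
    have ho := (charFun_sub_charFun_gaussianReal_isLittleO hS h2 h0 hv).comp_tendsto hr
    have h3 : (fun n : ℕ => ((n / l : ℕ) : ℝ) * ‖charFun (μ.map S) (r / √n) -
        charFun (gaussianReal 0 v) (r / √n)‖) =o[atTop]
        fun n : ℕ => ((n / l : ℕ) : ℝ) * (r / √n) ^ 2 :=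
      (Asymptotics.isBigO_refl _ _).mul_isLittleO ho.norm_left
    have h4 : Tendsto (fun n : ℕ => ((n / l : ℕ) : ℝ) * (r / √n) ^ 2) atTop
        (𝓝 (r ^ 2 * (l : ℝ)⁻¹)) := by
      refine (tendsto_natCast_div_div_natCast.const_mul (r ^ 2)).congr' ?_
      filter_upwards [hsq] with n hn
      rw [hn]
      ring
    refine squeeze_zero_norm (fun n => ?_)
      ((h3.trans_isBigO (h4.isBigO_one ℝ)).tendsto_zero_of_tendsto tendsto_const_nhds)
    exact norm_pow_sub_pow_le_mul (norm_charFun_le_one _) (norm_charFun_le_one _) _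
  simpa using hdiff.add hgauss

lemma IsAssociated.positivelyDependent_sum {μ : Measure Ω} [IsProbabilityMeasure μ] {ι : Type*}
    [DecidableEq ι] {V : ι → Ω → ℝ} (hV : IsAssociated μ V) (hm : ∀ i, Measurable (V i)) {C : ℝ}
    (hC : ∀ i ω, |V i ω| ≤ C) (A B : Finset ι) :
    PositivelyDependent μ (fun ω => ∑ i ∈ A, V i ω) (fun ω => ∑ i ∈ B, V i ω) := by
  intro f g hf hg hfm hgm
  have hb : ∀ (A : Finset ι) ω, |∑ i ∈ A, V i ω| ≤ A.card * C := fun A ω =>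
    (Finset.abs_sum_le_sum_abs _ _).trans
      ((Finset.sum_le_card_nsmul _ _ _ fun i _ => hC i ω).trans_eq (nsmul_eq_mul _ _))
  have memf := memLp_comp_of_continuous_of_bounded (μ := μ) (S := fun ω => ∑ i ∈ A, V i ω)
    (by fun_prop) (hb A) hf 2
  have memg := memLp_comp_of_continuous_of_bounded (μ := μ) (S := fun ω => ∑ i ∈ B, V i ω)
    (by fun_prop) (hb B) hg 2
  have := hV (A ∪ B)
    (fun x => f (∑ i ∈ A.attach, x ⟨i, Finset.mem_union_left _ i.2⟩))
    (fun x => g (∑ i ∈ B.attach, x ⟨i, Finset.mem_union_right _ i.2⟩))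
    (fun x y hxy => hfm (Finset.sum_le_sum fun i _ => hxy _))
    (fun x y hxy => hgm (Finset.sum_le_sum fun i _ => hxy _))
    (hf.measurable.comp (by fun_prop)) (hg.measurable.comp (by fun_prop))
  simp only [fun ω => A.sum_attach (fun i => V i ω), fun ω => B.sum_attach (fun i => V i ω)]
    at this
  exact this (memf.integrable (by norm_num)) (memg.integrable (by norm_num))
    (memf.integrable_mul memg)

lemma charFun_map_eq_integral {μ : Measure Ω} {S : Ω → ℝ} (hS : Measurable S) (r : ℝ) :
    charFun (μ.map S) r = ∫ ω, Complex.exp ((r * S ω : ℝ) * Complex.I) ∂μ := by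
  rw [charFun_apply_real, integral_map hS.aemeasurable (by fun_prop)]
  simp

/-- The sum of `l` consecutive terms of `V`, starting with `V a`. -/
def blockSum {α : Type*} (V : ℕ → α → ℝ) (a l : ℕ) (ω : α) : ℝ :=
  ∑ i ∈ Finset.range l, V (a + i) ω

lemma blockSum_add {α : Type*} (V : ℕ → α → ℝ) (a l : ℕ) :
    blockSum V 0 (a + l) = blockSum V 0 a + blockSum V a l := by
  ext ω
  simp [blockSum, Finset.sum_range_add]

/-- A strictly stationary sequence of associated centered variables, bounded by `C`. -/
structure IsStationaryAssociated (μ : Measure Ω) (V : ℕ → Ω → ℝ) (C : ℝ) : Prop where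
  measurable : ∀ i, Measurable (V i)
  abs_le : ∀ i ω, |V i ω| ≤ C
  integral_eq_zero : ∀ i, ∫ ω, V i ω ∂μ = 0
  isAssociated : IsAssociated μ V
  map_shift : ∀ k n : ℕ, μ.map (fun ω => fun i : Fin n => V (k + i) ω) =
    μ.map (fun ω => fun i : Fin n => V i ω)

namespace IsStationaryAssociated

variable {μ : Measure Ω} {V : ℕ → Ω → ℝ} {C : ℝ}

lemma measurable_blockSum (hV : IsStationaryAssociated μ V C) (a l : ℕ) :
    Measurable (blockSum V a l) :=
  Finset.measurable_fun_sum _ fun _ _ => hV.measurable _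

lemma abs_blockSum_le (hV : IsStationaryAssociated μ V C) (a l : ℕ) (ω : Ω) :
    |blockSum V a l ω| ≤ l * C := by
  refine (Finset.abs_sum_le_sum_abs _ _).trans
    ((Finset.sum_le_card_nsmul _ _ _ fun i _ => hV.abs_le _ ω).trans_eq ?_)
  rw [nsmul_eq_mul, Finset.card_range]

lemma map_blockSum (hV : IsStationaryAssociated μ V C) (a l : ℕ) :
    μ.map (blockSum V a l) = μ.map (blockSum V 0 l) := by
  have hs : Measurable fun x : Fin l → ℝ => ∑ i, x i := by fun_prop
  have h := congrArg (Measure.map fun x : Fin l → ℝ => ∑ i, x i) (hV.map_shift a l)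
  rw [Measure.map_map hs (measurable_pi_lambda _ fun i => hV.measurable _),
    Measure.map_map hs (measurable_pi_lambda _ fun i => hV.measurable _)] at h
  convert! h using 2 with ω
  · ext ω
    simp [blockSum, Finset.sum_range]
  · ext ω
    simp [blockSum, Finset.sum_range]

lemma variance_blockSum (hV : IsStationaryAssociated μ V C) (a l : ℕ) :
    variance (blockSum V a l) μ = variance (blockSum V 0 l) μ := by
  have h := congrArg (variance id) (hV.map_blockSum a l)
  rwa [variance_map aemeasurable_id (hV.measurable_blockSum a l).aemeasurable,
    variance_map aemeasurable_id (hV.measurable_blockSum 0 l).aemeasurable] at h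

lemma covariance_shift (hV : IsStationaryAssociated μ V C) (i j : ℕ) :
    covariance (V i) (V (i + j)) μ = covariance (V 0) (V j) μ := by
  have h := congrArg (covariance (fun x : Fin (j + 1) → ℝ => x 0) (fun x => x (Fin.last j)))
    (hV.map_shift i (j + 1))
  rw [covariance_map_fun (measurable_pi_apply _).aestronglyMeasurable
      (measurable_pi_apply _).aestronglyMeasurable
      (measurable_pi_lambda _ fun i => hV.measurable _).aemeasurable,
    covariance_map_fun (measurable_pi_apply _).aestronglyMeasurable
      (measurable_pi_apply _).aestronglyMeasurable
      (measurable_pi_lambda _ fun i => hV.measurable _).aemeasurable] at h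
  simpa using h

variable [IsProbabilityMeasure μ]

lemma memLp (hV : IsStationaryAssociated μ V C) (i : ℕ) : MemLp (V i) 2 μ :=
  .of_bound (hV.measurable i).aestronglyMeasurable C (.of_forall (hV.abs_le i))

lemma memLp_blockSum (hV : IsStationaryAssociated μ V C) (a l : ℕ) :
    MemLp (blockSum V a l) 2 μ :=
  .of_bound (hV.measurable_blockSum a l).aestronglyMeasurable _
    (.of_forall (hV.abs_blockSum_le a l))

lemma integral_blockSum (hV : IsStationaryAssociated μ V C) (a l : ℕ) :
    ∫ ω, blockSum V a l ω ∂μ = 0 := by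
  simp only [blockSum]
  rw [integral_finsetSum _ fun i _ => (hV.memLp _).integrable (by norm_num)]
  simp [hV.integral_eq_zero]

lemma positivelyDependent_blockSum (hV : IsStationaryAssociated μ V C) (a l : ℕ) :
    PositivelyDependent μ (blockSum V 0 a) (blockSum V a l) := by
  have := hV.isAssociated.positivelyDependent_sum hV.measurable hV.abs_le
    (Finset.range a) (Finset.Ico a (a + l))
  convert! this using 2
  · simp [blockSum]
  · simp [blockSum, Finset.sum_Ico_eq_sum_range]

lemma covariance_nonneg (hV : IsStationaryAssociated μ V C) (i j : ℕ) :
    0 ≤ covariance (V i) (V j) μ := by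
  have := hV.isAssociated.positivelyDependent_sum hV.measurable hV.abs_le {i} {j} id id
    continuous_id continuous_id monotone_id monotone_id
  simpa [cov_eq_covariance_s16 (hV.memLp i) (hV.memLp j)] using this

lemma variance_blockSum_add (hV : IsStationaryAssociated μ V C) (a l : ℕ) :
    variance (blockSum V 0 (a + l)) μ = variance (blockSum V 0 a) μ +
      2 * covariance (blockSum V 0 a) (blockSum V a l) μ + variance (blockSum V 0 l) μ := by
  rw [blockSum_add, variance_add (hV.memLp_blockSum _ _) (hV.memLp_blockSum _ _),
    hV.variance_blockSum a l]

lemma variance_blockSum_succ (hV : IsStationaryAssociated μ V C) (n : ℕ) :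
    variance (blockSum V 0 (n + 1)) μ = variance (blockSum V 0 n) μ +
      (covariance (V 0) (V 0) μ +
        2 * ∑ j ∈ Finset.range n, covariance (V 0) (V (j + 1)) μ) := by
  have h1 : ∀ a, blockSum V a 1 = V a := fun a => by ext; simp [blockSum]
  have h2 : covariance (blockSum V 0 n) (V n) μ =
      ∑ j ∈ Finset.range n, covariance (V 0) (V (j + 1)) μ := by
    have : blockSum V 0 n = fun ω => ∑ i ∈ Finset.range n, V i ω := by ext; simp [blockSum]
    rw [this, covariance_fun_sum_left' (fun i _ => hV.memLp i) (hV.memLp n),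
      ← Finset.sum_range_reflect]
    refine Finset.sum_congr rfl fun j hj => ?_
    rw [← hV.covariance_shift (n - 1 - j)]
    have := Finset.mem_range.1 hj
    congr 2
    omega
  rw [hV.variance_blockSum_add, h1, h1, h2, ← covariance_self (hV.measurable 0).aemeasurable]
  ring

/-- The limiting variance of the normalized partial sums. -/
def asymptoticVariance (μ : Measure Ω) (V : ℕ → Ω → ℝ) : ℝ :=
  covariance (V 0) (V 0) μ + 2 * ∑' j : ℕ, covariance (V 0) (V (j + 1)) μ

lemma variance_blockSum_eq_sum (hV : IsStationaryAssociated μ V C) (n : ℕ) :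
    variance (blockSum V 0 n) μ = ∑ i ∈ Finset.range n, (covariance (V 0) (V 0) μ +
        2 * ∑ j ∈ Finset.range i, covariance (V 0) (V (j + 1)) μ) := by
  induction n with
  | zero =>
    have : blockSum V 0 0 = 0 := by ext; simp [blockSum]
    simp [this]
  | succ n ih => rw [hV.variance_blockSum_succ, Finset.sum_range_succ, ih]

lemma variance_blockSum_le (hV : IsStationaryAssociated μ V C)
    (hs : Summable fun j : ℕ => covariance (V 0) (V (j + 1)) μ) (n : ℕ) :
    variance (blockSum V 0 n) μ ≤ n * asymptoticVariance μ V := by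
  rw [hV.variance_blockSum_eq_sum]
  refine (Finset.sum_le_card_nsmul _ _ (asymptoticVariance μ V) fun i _ => ?_).trans_eq
    (by simp)
  have := hs.sum_le_tsum (Finset.range i) fun j _ => hV.covariance_nonneg _ _
  unfold asymptoticVariance
  linarith

lemma tendsto_variance_blockSum_div (hV : IsStationaryAssociated μ V C)
    (hs : Summable fun j : ℕ => covariance (V 0) (V (j + 1)) μ) :
    Tendsto (fun n : ℕ => variance (blockSum V 0 n) μ / n) atTop
      (𝓝 (asymptoticVariance μ V)) := by
  have := ((hs.hasSum.tendsto_sum_nat.const_mul 2).const_add (covariance (V 0) (V 0) μ)).cesaro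
  refine this.congr fun n => ?_
  rw [hV.variance_blockSum_eq_sum, inv_mul_eq_div]

/-- Newman's inequality for the characteristic function of the sum of `m` blocks. -/
lemma norm_charFun_blockSum_mul_sub_pow_le (hV : IsStationaryAssociated μ V C) (l m : ℕ) (r : ℝ) :
    ‖charFun (μ.map (blockSum V 0 (m * l))) r - charFun (μ.map (blockSum V 0 l)) r ^ m‖ ≤
      2 * r ^ 2 * (variance (blockSum V 0 (m * l)) μ - m * variance (blockSum V 0 l) μ) := by
  induction m with
  | zero =>
    have : blockSum V 0 0 = fun _ => 0 := by ext; simp [blockSum]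
    simp only [zero_mul, pow_zero, this, Measure.map_const, measure_univ, one_smul,
      charFun_dirac, inner_zero_left, Complex.ofReal_zero, Complex.exp_zero, sub_self, norm_zero,
      Nat.cast_zero, sub_zero]
    exact mul_nonneg (by positivity) (variance_nonneg _ _)
  | succ m ih =>
    have key := (hV.positivelyDependent_blockSum (m * l) l).norm_integral_cexp_add_sub_le
      (hV.measurable_blockSum _ _) (hV.measurable_blockSum _ _) (hV.abs_blockSum_le _ _)
      (hV.abs_blockSum_le _ _) r
    have hadd : (fun ω => blockSum V 0 (m * l) ω + blockSum V (m * l) l ω) =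
        blockSum V 0 ((m + 1) * l) := by
      rw [add_mul, one_mul, blockSum_add]
      rfl
    rw [← charFun_map_eq_integral (hV.measurable_blockSum _ _),
      ← charFun_map_eq_integral (hV.measurable_blockSum _ _),
      ← charFun_map_eq_integral (S := fun ω => blockSum V 0 (m * l) ω + blockSum V (m * l) l ω)
        ((hV.measurable_blockSum _ _).add (hV.measurable_blockSum _ _)),
      hadd, hV.map_blockSum (m * l) l] at key
    have : IsProbabilityMeasure (μ.map (blockSum V 0 l)) :=
      Measure.isProbabilityMeasure_map (hV.measurable_blockSum _ _).aemeasurable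
    have hmul : ‖(charFun (μ.map (blockSum V 0 (m * l))) r -
        charFun (μ.map (blockSum V 0 l)) r ^ m) * charFun (μ.map (blockSum V 0 l)) r‖ ≤
        ‖charFun (μ.map (blockSum V 0 (m * l))) r -
        charFun (μ.map (blockSum V 0 l)) r ^ m‖ := by
      rw [norm_mul]
      exact mul_le_of_le_one_right (norm_nonneg _) (norm_charFun_le_one _)
    calc _ = ‖(charFun (μ.map (blockSum V 0 ((m + 1) * l))) r -
          charFun (μ.map (blockSum V 0 (m * l))) r * charFun (μ.map (blockSum V 0 l)) r) +
          (charFun (μ.map (blockSum V 0 (m * l))) r -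
        charFun (μ.map (blockSum V 0 l)) r ^ m) * charFun (μ.map (blockSum V 0 l)) r‖ := by
          congr 1; ring
      _ ≤ _ := (norm_add_le _ _).trans (add_le_add key (hmul.trans ih))
      _ = _ := by
        rw [add_mul m 1 l, one_mul, hV.variance_blockSum_add (m * l) l]
        push_cast
        ring

lemma norm_charFun_blockSum_add_sub_le (hV : IsStationaryAssociated μ V C) (a l : ℕ) (r : ℝ) :
    ‖charFun (μ.map (blockSum V 0 (a + l))) r - charFun (μ.map (blockSum V 0 a)) r‖ ≤
      |r| * (l * C) := by
  have hint : ∀ n, Integrable (fun ω => Complex.exp ((r * blockSum V 0 n ω : ℝ) * Complex.I)) μ :=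
    fun n => .of_bound
      (by have := hV.measurable_blockSum 0 n; fun_prop) 1
      (.of_forall fun ω => (Complex.norm_exp_ofReal_mul_I _).le)
  rw [charFun_map_eq_integral (hV.measurable_blockSum _ _),
    charFun_map_eq_integral (hV.measurable_blockSum _ _), ← integral_sub (hint _) (hint _)]
  refine (norm_integral_le_of_norm_le_const (C := |r| * (l * C)) (.of_forall fun ω => ?_)).trans
    (by simp)
  rw [blockSum_add, Pi.add_apply, mul_add, Complex.ofReal_add, add_mul, Complex.exp_add,
    ← mul_sub_one, norm_mul, Complex.norm_exp_ofReal_mul_I, one_mul, mul_comm _ Complex.I]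
  refine Real.norm_exp_I_mul_ofReal_sub_one_le.trans ?_
  rw [norm_mul, Real.norm_eq_abs, Real.norm_eq_abs]
  gcongr
  exact hV.abs_blockSum_le _ _ _

lemma tendsto_charFun_blockSum (hV : IsStationaryAssociated μ V C)
    (hs : Summable fun j : ℕ => covariance (V 0) (V (j + 1)) μ) (r : ℝ) :
    Tendsto (fun n : ℕ => charFun (μ.map (blockSum V 0 n)) (r / √n)) atTop
      (𝓝 (Complex.exp (-(r ^ 2 * asymptoticVariance μ V / 2) : ℝ))) := by
  set σ2 := asymptoticVariance μ V with hσ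
  set v : ℕ → ℝ := fun n => variance (blockSum V 0 n) μ
  have hv : Tendsto (fun n : ℕ => v n / n) atTop (𝓝 σ2) := hV.tendsto_variance_blockSum_div hs
  have hE : Continuous fun x : ℝ => Complex.exp (-(r ^ 2 * x / 2) : ℝ) := by fun_prop
  have hl : Tendsto (fun l : ℕ => 2 * r ^ 2 * (σ2 - v l / l) +
      ‖Complex.exp (-(r ^ 2 * (v l / l) / 2) : ℝ) - Complex.exp (-(r ^ 2 * σ2 / 2) : ℝ)‖) atTop
      (𝓝 0) := by
    have h1 := (hv.const_sub σ2).const_mul (2 * r ^ 2)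
    have h2 := (((hE.tendsto σ2).comp hv).sub_const
      (Complex.exp (-(r ^ 2 * σ2 / 2) : ℝ))).norm
    simpa using h1.add h2
  rw [Metric.tendsto_atTop]
  simp_rw [dist_eq_norm]
  intro ε hε
  obtain ⟨l, hlε, hl0⟩ := ((hl.eventually_lt_const (half_pos hε)).and
    (eventually_gt_atTop 0)).exists
  have hl0' : (0 : ℝ) < l := Nat.cast_pos.2 hl0
  have hblock := tendsto_charFun_div_sqrt_pow_div (hV.measurable_blockSum 0 l)
    (hV.memLp_blockSum 0 l) (hV.integral_blockSum 0 l) l r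
  have hrem : Tendsto (fun n : ℕ => |r / √n| * (l * C)) atTop (𝓝 0) := by
    have : Tendsto (fun n : ℕ => r / √n) atTop (𝓝 0) :=
      tendsto_const_nhds.div_atTop (Real.tendsto_sqrt_atTop.comp tendsto_natCast_atTop_atTop)
    simpa using this.abs.mul_const (l * C)
  have hsmall := ((hblock.sub_const
    (Complex.exp (-(r ^ 2 * (v l / l) / 2) : ℝ))).norm).add hrem
  rw [sub_self, norm_zero, add_zero] at hsmall
  obtain ⟨N, hN⟩ := eventually_atTop.1 ((hsmall.eventually_lt_const (half_pos hε)).and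
    (eventually_gt_atTop 0))
  refine ⟨N, fun n hn => ?_⟩
  obtain ⟨hnε, hn0⟩ := hN n hn
  have hC : 0 ≤ C := (abs_nonneg _).trans
    (hV.abs_le 0 (Measure.nonempty_of_neZero μ).some)
  have hn0' : (0 : ℝ) < n := Nat.cast_pos.2 hn0
  have h1 : ‖charFun (μ.map (blockSum V 0 n)) (r / √n) -
      charFun (μ.map (blockSum V 0 (n / l * l))) (r / √n)‖ ≤ |r / √n| * (l * C) := by
    have := hV.norm_charFun_blockSum_add_sub_le (n / l * l) (n % l) (r / √n)
    rw [Nat.div_add_mod'] at this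
    refine this.trans ?_
    gcongr
    exact (Nat.mod_lt _ hl0).le
  have h2 : ‖charFun (μ.map (blockSum V 0 (n / l * l))) (r / √n) -
      charFun (μ.map (blockSum V 0 l)) (r / √n) ^ (n / l)‖ ≤ 2 * r ^ 2 * (σ2 - v l / l) := by
    refine (hV.norm_charFun_blockSum_mul_sub_pow_le l (n / l) (r / √n)).trans ?_
    have hle := hV.variance_blockSum_le hs (n / l * l)
    have hlσ : 0 ≤ σ2 - v l / l := by
      rw [sub_nonneg, div_le_iff₀ hl0', mul_comm]
      exact hV.variance_blockSum_le hs l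
    have hml : ((n / l * l : ℕ) : ℝ) ≤ n := Nat.cast_le.2 (Nat.div_mul_le_self n l)
    have hve : ((n / l : ℕ) : ℝ) * v l = ((n / l * l : ℕ) : ℝ) * (v l / l) := by
      push_cast
      field_simp
    rw [div_pow, Real.sq_sqrt hn0'.le]
    calc _ ≤ 2 * (r ^ 2 / n) * (n * (σ2 - v l / l)) := by
          gcongr
          change _ - ((n / l : ℕ) : ℝ) * v l ≤ _
          rw [hve]
          calc _ ≤ ((n / l * l : ℕ) : ℝ) * (σ2 - v l / l) := by
                rw [mul_sub]
                gcongr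
            _ ≤ _ := by gcongr
      _ = _ := by field_simp
  calc _ ≤ ‖charFun (μ.map (blockSum V 0 n)) (r / √n) -
      charFun (μ.map (blockSum V 0 (n / l * l))) (r / √n)‖ +
      ‖charFun (μ.map (blockSum V 0 (n / l * l))) (r / √n) -
      charFun (μ.map (blockSum V 0 l)) (r / √n) ^ (n / l)‖ +
      ‖charFun (μ.map (blockSum V 0 l)) (r / √n) ^ (n / l) -
        Complex.exp (-(r ^ 2 * (v l / l) / 2) : ℝ)‖ +
      ‖Complex.exp (-(r ^ 2 * (v l / l) / 2) : ℝ) - Complex.exp (-(r ^ 2 * σ2 / 2) : ℝ)‖ := by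
        refine (norm_sub_le_norm_sub_add_norm_sub _ _ _).trans (add_le_add ?_ le_rfl)
        refine (norm_sub_le_norm_sub_add_norm_sub _ _ _).trans (add_le_add ?_ le_rfl)
        exact norm_sub_le_norm_sub_add_norm_sub _ _ _
    _ < ε := by
      have : ‖charFun (μ.map (blockSum V 0 l)) (r / √n) ^ (n / l) -
        Complex.exp (-(r ^ 2 * (v l / l) / 2) : ℝ)‖ + |r / √n| * (l * C) < ε / 2 := hnε
      linarith

/-- Newman's central limit theorem for bounded stationary associated sequences. -/
theorem tendstoStdGaussian (hV : IsStationaryAssociated μ V C)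
    (hs : Summable fun j : ℕ => covariance (V 0) (V (j + 1)) μ)
    (hpos : 0 < asymptoticVariance μ V) :
    TendstoStdGaussian μ fun n ω =>
      (√n * √(asymptoticVariance μ V))⁻¹ * blockSum V 0 n ω := by
  set σ2 := asymptoticVariance μ V
  have hm : ∀ n : ℕ, Measurable fun ω => (√n * √σ2)⁻¹ * blockSum V 0 n ω := fun n =>
    (hV.measurable_blockSum 0 n).const_mul _
  let P : ℕ → ProbabilityMeasure ℝ := fun n =>
    ⟨μ.map fun ω => (√n * √σ2)⁻¹ * blockSum V 0 n ω,
      Measure.isProbabilityMeasure_map (hm n).aemeasurable⟩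
  have hP : Tendsto P atTop (𝓝 ⟨gaussianReal 0 1, inferInstance⟩) := by
    refine ProbabilityMeasure.tendsto_of_tendsto_charFun fun r => ?_
    convert! hV.tendsto_charFun_blockSum hs (r / √σ2) using 2 with n
    · change charFun (μ.map fun ω => (√n * √σ2)⁻¹ * blockSum V 0 n ω) r = _
      rw [charFun_map_mul_comp (hV.measurable_blockSum 0 n).aemeasurable]
      congr 1
      field_simp
    · change charFun (gaussianReal 0 1) r = _
      rw [charFun_gaussianReal, div_pow, Real.sq_sqrt hpos.le, div_mul_cancel₀ _ hpos.ne']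
      congr 1
      push_cast
      simp
  intro f
  have := ProbabilityMeasure.tendsto_iff_forall_integral_tendsto.1 hP f
  refine this.congr fun n => ?_
  exact integral_map (hm n).aemeasurable f.continuous.aestronglyMeasurable

end IsStationaryAssociated

/-- A family of antitone functions of pairs of associated variables is associated. -/
lemma IsAssociated.antitone_comp_pair {μ : Measure Ω} {ι κ : Type*} [DecidableEq ι]
    {X : ι → Ω → ℝ} (hX : IsAssociated μ X) (a b : κ → ι) {F : ℝ × ℝ → ℝ} (hF : Antitone F)
    (hFm : Measurable F) : IsAssociated μ fun i ω => F (X (a i) ω, X (b i) ω) := by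
  intro S h g hh hg hhm hgm hhi hgi hhgi
  let T : Finset ι := S.image a ∪ S.image b
  have ha : ∀ i : S, a i ∈ T := fun i =>
    Finset.mem_union_left _ (Finset.mem_image_of_mem _ i.2)
  have hb : ∀ i : S, b i ∈ T := fun i =>
    Finset.mem_union_right _ (Finset.mem_image_of_mem _ i.2)
  let G : (T → ℝ) → S → ℝ := fun x i => F (x ⟨a i, ha i⟩, x ⟨b i, hb i⟩)
  have hG : Antitone G := fun x y hxy i => hF ⟨hxy _, hxy _⟩
  have hGm : Measurable G := measurable_pi_lambda _ fun i => hFm.comp (by fun_prop)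
  have := hX T (fun x => -h (G x)) (fun x => -g (G x))
    (fun x y hxy => neg_le_neg (hh (hG hxy))) (fun x y hxy => neg_le_neg (hg (hG hxy)))
    (hhm.comp hGm).neg (hgm.comp hGm).neg hhi.neg hgi.neg (by simpa [G] using hhgi)
  simpa [cov, G, integral_neg] using this

lemma map_shift_of_strictStationary {μ : Measure Ω} {X : ℕ → Ω → ℝ}
    (hX : StrictStationary μ X) (hm : ∀ j, Measurable (X j)) {F : ℝ × ℝ → ℝ} (hF : Measurable F)
    (d k n : ℕ) :
    μ.map (fun ω => fun i : Fin n => F (X (k + i + 1) ω, X (k + i + 1 + d) ω)) =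
      μ.map (fun ω => fun i : Fin n => F (X (i + 1) ω, X (i + 1 + d) ω)) := by
  let G : (Fin (n + d) → ℝ) → Fin n → ℝ :=
    fun x i => F (x (Fin.castAdd d i), x ⟨i + d, by omega⟩)
  have hG : Measurable G := measurable_pi_lambda _ fun i => hF.comp (by fun_prop)
  have h := congrArg (Measure.map G) (hX k (n + d))
  rw [Measure.map_map hG (measurable_pi_lambda _ fun i => hm _),
    Measure.map_map hG (measurable_pi_lambda _ fun i => hm _)] at h
  convert! h using 2
  · ext ω i
    simp only [Function.comp_apply, G, Fin.val_castAdd]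
    rw [show k + (i : ℕ) + 1 = 1 + i + k by omega,
      show 1 + (i : ℕ) + k + d = 1 + (i + d) + k by omega]
  · ext ω i
    simp only [Function.comp_apply, G, Fin.val_castAdd]
    rw [show (i : ℕ) + 1 = 1 + i by omega, show 1 + (i : ℕ) + d = 1 + (i + d) by omega]

/-- The quadrant indicator `I(x ≤ s, y ≤ t)`, centered at `p`. -/
def centeredQuadrantIndicator (s t p : ℝ) (x : ℝ × ℝ) : ℝ :=
  Set.indicator (Set.Iic s ×ˢ Set.Iic t) (fun _ => (1 : ℝ)) x - p

lemma antitone_centeredQuadrantIndicator (s t p : ℝ) :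
    Antitone (centeredQuadrantIndicator s t p) := by
  intro x y hxy
  refine sub_le_sub_right ?_ p
  by_cases hy : y ∈ Set.Iic s ×ˢ Set.Iic t
  · have hx : x ∈ Set.Iic s ×ˢ Set.Iic t := ⟨hxy.1.trans hy.1, hxy.2.trans hy.2⟩
    simp only [Set.indicator_of_mem hx, Set.indicator_of_mem hy, le_refl]
  · rw [Set.indicator_of_notMem hy]
    exact Set.indicator_nonneg (fun _ _ => zero_le_one) _

lemma measurable_centeredQuadrantIndicator (s t p : ℝ) :
    Measurable (centeredQuadrantIndicator s t p) :=
  (measurable_const.indicator (measurableSet_Iic.prod measurableSet_Iic)).sub_const p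

lemma abs_centeredQuadrantIndicator_le (s t p : ℝ) (x : ℝ × ℝ) :
    |centeredQuadrantIndicator s t p x| ≤ 1 + |p| := by
  refine (abs_sub _ _).trans ?_
  gcongr
  by_cases hx : x ∈ Set.Iic s ×ˢ Set.Iic t
  · rw [Set.indicator_of_mem hx, abs_one]
  · rw [Set.indicator_of_notMem hx, abs_zero]
    exact zero_le_one

lemma Yind_sub_eq_centeredQuadrantIndicator {α : Type*} (X : ℕ → α → ℝ) (k : ℕ) (s t p : ℝ)
    (i : ℕ) (ω : α) :
    Yind X k s t i ω - p = centeredQuadrantIndicator s t p (X i ω, X (i + k) ω) := by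
  simp [Yind, centeredQuadrantIndicator, Set.indicator]

lemma measurable_Yind {X : ℕ → Ω → ℝ} (hm : ∀ j, Measurable (X j)) (k : ℕ) (s t : ℝ) (i : ℕ) :
    Measurable (Yind X k s t i) :=
  measurable_const.indicator
    ((measurableSet_le (hm _) measurable_const).inter (measurableSet_le (hm _) measurable_const))

lemma memLp_Yind {μ : Measure Ω} [IsFiniteMeasure μ] {X : ℕ → Ω → ℝ} (hm : ∀ j, Measurable (X j))
    (k : ℕ) (s t : ℝ) (i : ℕ) (p : ENNReal) : MemLp (Yind X k s t i) p μ :=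
  .of_bound (measurable_Yind hm k s t i).aestronglyMeasurable 1
    (.of_forall fun ω => by unfold Yind Set.indicator; split_ifs <;> simp)

lemma integral_Yind {μ : Measure Ω} {X : ℕ → Ω → ℝ} (hm : ∀ j, Measurable (X j))
    (k : ℕ) (s t : ℝ) (i : ℕ) :
    ∫ ω, Yind X k s t i ω ∂μ = (μ {ω | X i ω ≤ s ∧ X (i + k) ω ≤ t}).toReal := by
  have hms : MeasurableSet {ω | X i ω ≤ s ∧ X (i + k) ω ≤ t} :=
    (measurableSet_le (hm _) measurable_const).inter (measurableSet_le (hm _) measurable_const)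
  simp only [Yind]
  rw [integral_indicator_const _ hms]
  simp [Measure.real]

lemma isStationaryAssociated_Yind_sub {μ : Measure Ω} [IsProbabilityMeasure μ]
    {X : ℕ → Ω → ℝ} (hm : ∀ j, Measurable (X j)) (hstat : StrictStationary μ X)
    (hassoc : IsAssociated μ X) (k : ℕ) (s t p : ℝ)
    (hp : p = (μ {ω | X 1 ω ≤ s ∧ X (1 + k) ω ≤ t}).toReal) :
    IsStationaryAssociated μ (fun i ω => Yind X k s t (i + 1) ω - p) (1 + |p|) where
  measurable i := (measurable_Yind hm k s t (i + 1)).sub_const p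
  abs_le i ω := by
    rw [Yind_sub_eq_centeredQuadrantIndicator]
    exact abs_centeredQuadrantIndicator_le _ _ _ _
  integral_eq_zero i := by
    have h := congrArg (fun ν : Measure (Fin 1 → ℝ) => ∫ x, x 0 ∂ν)
      (map_shift_of_strictStationary hstat hm (measurable_centeredQuadrantIndicator s t p) k i 1)
    have hmeas : ∀ i, Measurable fun ω =>
        centeredQuadrantIndicator s t p (X i ω, X (i + k) ω) := fun i =>
      (measurable_centeredQuadrantIndicator s t p).comp ((hm _).prodMk (hm _))
    rw [integral_map (measurable_pi_lambda _ fun _ => hmeas _).aemeasurable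
        (measurable_pi_apply _).aestronglyMeasurable,
      integral_map (measurable_pi_lambda _ fun _ => hmeas _).aemeasurable
        (measurable_pi_apply _).aestronglyMeasurable] at h
    simp only [Fin.val_zero, add_zero, zero_add,
      ← Yind_sub_eq_centeredQuadrantIndicator] at h
    rw [h, integral_sub ((memLp_Yind hm k s t 1 1).integrable le_rfl) (integrable_const _),
      integral_Yind hm, ← hp]
    simp
  isAssociated := by
    simp only [Yind_sub_eq_centeredQuadrantIndicator]
    exact hassoc.antitone_comp_pair (fun i => i + 1) (fun i => i + 1 + k)
      (antitone_centeredQuadrantIndicator s t p) (measurable_centeredQuadrantIndicator s t p)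
  map_shift a n := by
    simp only [Yind_sub_eq_centeredQuadrantIndicator]
    exact map_shift_of_strictStationary hstat hm (measurable_centeredQuadrantIndicator s t p) k a n

/-- CLT for the histogram estimator `U_n(s,t) = (n−k)⁻¹ ∑_{i=1}^{n−k} Y_{i,i+k}` of the
two-dimensional distribution function `P(X₁ ≤ s, X_{k+1} ≤ t)`, where
`σ² = Var(Y_{1,1+k}) + 2 ∑_{j=2}^∞ Cov(Y_{1,1+k}, Y_{j,j+k})`, `0 < σ² < ∞`. -/
theorem histogram_estimator_clt (μ : Measure Ω) [IsProbabilityMeasure μ]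
    (X : ℕ → Ω → ℝ) (hmeas : ∀ j, Measurable (X j))
    (hstat : StrictStationary μ X) (hassoc : IsAssociated μ X)
    (C₁ : ℝ) (hbdd : ∀ n : ℕ, 1 ≤ n → ∀ ω, |X n ω| ≤ C₁)
    (hdens : ∀ j : ℕ, 1 ≤ j → HasBddContDensity μ (X j))
    (s t : ℝ) (k : ℕ) (hk : 1 ≤ k)
    (δ : ℝ) (hδ0 : 0 < δ) (hδ : δ < 1 / 2)
    (hsumδ : Summable fun j : ℕ => cov μ (X 1) (X (j + 1)) ^ δ)
    (hsumY : Summable fun j : ℕ => cov μ (Yind X k s t 1) (Yind X k s t (j + 2)))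
    (σ2 : ℝ)
    (hσ2 : σ2 = cov μ (Yind X k s t 1) (Yind X k s t 1) +
      2 * ∑' j : ℕ, cov μ (Yind X k s t 1) (Yind X k s t (j + 2)))
    (hσpos : 0 < σ2) :
    TendstoStdGaussian μ fun n ω =>
      Real.sqrt ((n : ℝ) - (k : ℝ)) *
        ((1 / ((n : ℝ) - (k : ℝ))) * ∑ i ∈ Finset.Icc 1 (n - k), Yind X k s t i ω -
          (μ {ω' | X 1 ω' ≤ s ∧ X (1 + k) ω' ≤ t}).toReal) / Real.sqrt σ2 := by
  set p : ℝ := (μ {ω' | X 1 ω' ≤ s ∧ X (1 + k) ω' ≤ t}).toReal with hp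
  let V : ℕ → Ω → ℝ := fun i ω => Yind X k s t (i + 1) ω - p
  have hV : IsStationaryAssociated μ V (1 + |p|) :=
    isStationaryAssociated_Yind_sub hmeas hstat hassoc k s t p hp
  have hcov : ∀ i, covariance (V 0) (V i) μ =
      cov μ (Yind X k s t 1) (Yind X k s t (i + 1)) := fun i => by
    have h2 := fun i => memLp_Yind (μ := μ) hmeas k s t i 2
    rw [cov_eq_covariance_s16 (h2 _) (h2 _)]
    simp only [V]
    rw [covariance_sub_const_left ((h2 _).integrable (by norm_num)),
      covariance_sub_const_right ((h2 _).integrable (by norm_num))]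
  have hσ : σ2 = IsStationaryAssociated.asymptoticVariance μ V := by
    simp only [hσ2, IsStationaryAssociated.asymptoticVariance, hcov]
  have hclt := hV.tendstoStdGaussian (by simpa only [hcov] using hsumY) (hσ ▸ hσpos)
  rw [← hσ] at hclt
  intro f
  refine ((hclt f).comp (tendsto_sub_atTop_nat k)).congr' ?_
  filter_upwards [eventually_gt_atTop k] with n hn
  simp only [Function.comp_apply]
  congr 1
  ext ω
  congr 1
  have hN : (0 : ℝ) < (n : ℝ) - k := sub_pos.2 (Nat.cast_lt.2 hn)
  have hsum : ∑ i ∈ Finset.Icc 1 (n - k), Yind X k s t i ω =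
      blockSum V 0 (n - k) ω + ((n : ℝ) - k) * p := by
    simp only [blockSum, V, zero_add, Finset.sum_sub_distrib, Finset.sum_const, Finset.card_range,
      nsmul_eq_mul, Nat.cast_sub hn.le, sub_add_cancel]
    rw [← Finset.Ico_add_one_right_eq_Icc, Finset.sum_Ico_eq_sum_range]
    simp [add_comm]
  rw [hsum, Nat.cast_sub hn.le]
  have hsq := Real.mul_self_sqrt hN.le
  have h1 : √((n : ℝ) - k) ≠ 0 := (Real.sqrt_pos.2 hN).ne'
  have h2 : √σ2 ≠ 0 := (Real.sqrt_pos.2 hσpos).ne'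
  rw [one_div, mul_add, inv_mul_cancel_left₀ hN.ne', add_sub_cancel_right]
  nth_rewrite 3 [← hsq]
  field_simp
end
end
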